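/- arXiv:2104.06948 — 2 statements merged into one kernel-verified Lean document; each statement's English description precedes it below -/
import Mathlib

section
/- Under Condition (6), for every j ∈ ℕ, Φ_j(2e^T) − Φ_j(e^T) ~ (log 2)(Γ(β+1))^j / Γ(j(β+1)) · T^{jβ+j−1} (ℓ(T))^j as T → ∞ (i.e., the ratio of the two sides tends to 1). -/
open Filter Topology

/-- Product weight of a box `r` in generation `j`: `p_r = p_{r 0} ⋯ p_{r (j-1)}`. -/
noncomputable def prodP (p : ℕ → ℝ) (j : ℕ) (r : Fin j → ℕ) : ℝ := ∏ i, p (r i)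

/-- Counting function of generation `j`: `ρ_j(x) = #{r ∈ ℕ^j : p_r ≥ 1/x}` (as a real number). -/
noncomputable def rhoJ (p : ℕ → ℝ) (j : ℕ) (x : ℝ) : ℝ :=
  (Nat.card {r : Fin j → ℕ // 1 / x ≤ prodP p j r} : ℝ)

/-- Expected number of occupied boxes in generation `j` of the Poissonized scheme:
`Φ_j(t) = ∑_{r ∈ ℕ^j} (1 - e^{-t p_r})`. -/
noncomputable def PhiJ (p : ℕ → ℝ) (j : ℕ) (t : ℝ) : ℝ :=
  ∑' r : Fin j → ℕ, (1 - Real.exp (-t * prodP p j r))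


/-- Stolz-Cesaro: regular variation of R along integers. -/
lemma aux_stolz (R S : ℝ → ℝ) (κ : ℝ) (hRmono : Monotone R) (hRtop : Tendsto R atTop atTop)
    (h : Tendsto (fun T => (S (T+1) - S T) / (R (T+1) - R T)) atTop (𝓝 κ))
    (hpos : ∀ᶠ T in atTop, 0 < R (T+1) - R T) :
    Tendsto (fun n : ℕ => S n / R n) atTop (𝓝 κ) := by
  have hcast : Tendsto (fun n : ℕ => (n:ℝ)) atTop atTop := tendsto_natCast_atTop_atTop
  have h1 : (fun n : ℕ => (S ((n:ℝ)+1) - S n) - κ * (R ((n:ℝ)+1) - R n)) =o[atTop]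
      (fun n : ℕ => R ((n:ℝ)+1) - R n) := by
    rw [Asymptotics.isLittleO_iff_tendsto']
    · have h2 := (h.comp hcast).sub_const κ
      rw [sub_self] at h2
      refine h2.congr' ?_
      filter_upwards [hcast.eventually hpos] with n hn
      simp only [Function.comp]
      field_simp
    · filter_upwards [hcast.eventually hpos] with n hn h0
      exact absurd h0 hn.ne'
  have hsumR : ∀ n : ℕ, ∑ i ∈ Finset.range n, (R ((i:ℝ)+1) - R i) = R n - R 0 := by
    intro n
    have := Finset.sum_range_sub (fun i : ℕ => R i) n
    simpa using this
  have hsumS : ∀ n : ℕ, ∑ i ∈ Finset.range n, (S ((i:ℝ)+1) - S i) = S n - S 0 := by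
    intro n
    have := Finset.sum_range_sub (fun i : ℕ => S i) n
    simpa using this
  have h3 := h1.sum_range (fun n => sub_nonneg.2 (hRmono (by linarith))) (by
    simp only [hsumR]
    exact tendsto_atTop_add_const_right _ _ (hRtop.comp hcast))
  simp only [Finset.sum_sub_distrib, ← Finset.mul_sum] at h3
  simp only [← Finset.sum_sub_distrib, hsumR, hsumS] at h3
  have hRn : Tendsto (fun n : ℕ => R n) atTop atTop := hRtop.comp hcast
  have h4 := (h3.tendsto_div_nhds_zero)
  have h5 : Tendsto (fun n : ℕ => (R n - R 0) / R n) atTop (𝓝 1) := by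
    have : Tendsto (fun n : ℕ => 1 - R 0 / R n) atTop (𝓝 (1 - 0)) :=
      tendsto_const_nhds.sub (hRn.const_div_atTop _)
    rw [sub_zero] at this
    refine this.congr' ?_
    filter_upwards [hRn.eventually_gt_atTop 0] with n hn
    field_simp
  have h6 : Tendsto (fun n : ℕ => (S 0 - κ * R 0) / R n) atTop (𝓝 0) := hRn.const_div_atTop _
  have h7 := ((h4.mul h5).add h6).add_const κ
  simp only [zero_mul, zero_add] at h7
  refine h7.congr' ?_
  filter_upwards [hRn.eventually_gt_atTop 0, hRn.eventually_gt_atTop (R 0)] with n hn hn'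
  have : R n - R 0 ≠ 0 := by linarith [hn'] |> fun (h : 0 < R n - R 0) => h.ne'
  field_simp
  ring

lemma aux_regvar (R L : ℝ → ℝ) (β : ℝ) (hRmono : Monotone R)
    (hRtop : Tendsto R atTop atTop) (hRpos : ∀ T, 0 ≤ R T)
    (hLpos : ∀ᶠ T in atTop, 0 < L T)
    (hL : ∀ h > 0, Tendsto (fun T => (R (T+h) - R T) / L T) atTop (𝓝 h))
    (hLrv : ∀ c > 0, Tendsto (fun T => L (c*T) / L T) atTop (𝓝 (c^β)))
    (hβ : 0 ≤ β) (c : ℝ) (hc : 0 < c) :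
    Tendsto (fun T => R (c*T) / R T) atTop (𝓝 (c^(β+1))) := by
  have hpos : ∀ᶠ T in atTop, 0 < R (T+1) - R T := by
    filter_upwards [hLpos, (hL 1 one_pos).eventually_const_lt (zero_lt_one)] with T h1 h2
    exact (div_pos_iff_of_pos_right h1).1 h2
  have hint : ∀ c > 0, Tendsto (fun n : ℕ => R (c*n) / R n) atTop (𝓝 (c^(β+1))) := by
    intro c hc
    refine aux_stolz R (fun T => R (c*T)) _ hRmono hRtop ?_ hpos
    have hcT : Tendsto (fun T : ℝ => c * T) atTop atTop := tendsto_id.const_mul_atTop hc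
    have h1 := ((hL c hc).comp hcT).mul (hLrv c hc)
    have h2 := h1.div (hL 1 one_pos) one_ne_zero
    rw [div_one, ← Real.rpow_one_add' (by positivity) (by positivity), add_comm 1 β] at h2
    refine h2.congr' ?_
    filter_upwards [hLpos, hcT.eventually hLpos, hpos] with T h1 h2 h3
    simp only [Function.comp, mul_add, mul_one, Pi.div_apply]
    field_simp
  have hfl : Tendsto (fun T : ℝ => ⌊T⌋₊) atTop atTop := tendsto_nat_floor_atTop
  have hb : 0 < β + 1 := by positivity
  -- key: squeeze
  have key : ∀ e > 0, ∀ᶠ T in atTop, (R (c * ⌊T⌋₊)/ R ⌊T⌋₊) / (R ((1+e) * ⌊T⌋₊) / R ⌊T⌋₊) ≤ R (c*T)/R T ∧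
      R (c*T)/R T ≤ R ((c*(1+e)) * ⌊T⌋₊) / R ⌊T⌋₊ := by
    intro e he
    filter_upwards [eventually_ge_atTop (1/e + 1), (hRtop.comp (tendsto_natCast_atTop_atTop.comp hfl)).eventually_gt_atTop 0,
      eventually_ge_atTop 0] with T hT hR hT0
    simp only [Function.comp] at hR
    have f1 : (⌊T⌋₊:ℝ) ≤ T := Nat.floor_le hT0
    have f2 : T < ⌊T⌋₊ + 1 := Nat.lt_floor_add_one T
    have f3 : 1 ≤ e * ⌊T⌋₊ := by
      have : 1/e ≤ ⌊T⌋₊ := by linarith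
      rwa [div_le_iff₀' he] at this
    have f4 : T ≤ (1+e) * ⌊T⌋₊ := by linarith
    have g1 := hRmono f1
    have g2 := hRmono f4
    have g3 : R (c*T) ≤ R ((c*(1+e)) * ⌊T⌋₊) := hRmono (by rw [mul_assoc]; gcongr)
    have g4 : R (c* ⌊T⌋₊) ≤ R (c*T) := hRmono (by gcongr)
    constructor
    · rw [div_div_div_cancel_right₀ hR.ne']
      exact div_le_div₀ (hRpos _) g4 (by linarith) g2
    · exact div_le_div₀ (hRpos _) g3 hR g1
  rw [tendsto_order]
  constructor
  · intro a ha
    have hlim : Tendsto (fun e : ℝ => c^(β+1) / (1+e)^(β+1)) (𝓝[>] 0) (𝓝 (c^(β+1) / (1+0)^(β+1))) := by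
      apply Tendsto.mono_left _ nhdsWithin_le_nhds
      refine ContinuousAt.tendsto (f := fun e : ℝ => c^(β+1) / (1+e)^(β+1)) ?_
      refine ContinuousAt.div continuousAt_const (ContinuousAt.rpow_const (by fun_prop) (by simp)) (by simp)
    simp only [add_zero, Real.one_rpow, div_one] at hlim
    obtain ⟨e, he1, he⟩ := ((hlim.eventually_const_lt ha).and self_mem_nhdsWithin).exists
    have he : 0 < e := he
    have := (((hint c hc).div (hint (1+e) (by positivity)) (by positivity)).comp hfl).eventually_const_lt he1
    filter_upwards [this, key e he] with T h1 h2
    exact lt_of_lt_of_le h1 h2.1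
  · intro a ha
    have hlim : Tendsto (fun e : ℝ => (c*(1+e))^(β+1)) (𝓝[>] 0) (𝓝 ((c*(1+0))^(β+1))) := by
      apply Tendsto.mono_left _ nhdsWithin_le_nhds
      refine ContinuousAt.tendsto (f := fun e : ℝ => (c*(1+e))^(β+1)) ?_
      exact (ContinuousAt.rpow_const (by fun_prop) (by simp [hc.ne']))
    simp only [add_zero, mul_one] at hlim
    obtain ⟨e, he1, he⟩ := ((hlim.eventually_lt_const ha).and self_mem_nhdsWithin).exists
    have he : 0 < e := he
    have := ((hint (c*(1+e)) (by positivity)).comp hfl).eventually_lt_const he1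
    filter_upwards [this, key e he] with T h1 h2
    exact lt_of_le_of_lt h2.2 h1

lemma aux_intbound (R : ℝ → ℝ) (hRmono : Monotone R) (T : ℝ) (hT : 0 < T) :
    T * (∫ x in (1:ℝ)..2, (R (x*T+1) - R (x*T))) ≤ R (2*T+1) - R T ∧
    R (2*T) - R (T+1) ≤ T * (∫ x in (1:ℝ)..2, (R (x*T+1) - R (x*T))) := by
  have hi : ∀ a b, IntervalIntegrable R MeasureTheory.volume a b := fun a b => hRmono.intervalIntegrable
  have hm1 : Monotone (fun u => R (u+1)) := fun a b h => hRmono (by linarith)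
  have hi1 : ∀ a b, IntervalIntegrable (fun u => R (u+1)) MeasureTheory.volume a b :=
    fun a b => hm1.intervalIntegrable
  have e1 : (∫ x in (1:ℝ)..2, (R (x*T+1) - R (x*T))) = T⁻¹ * ∫ u in (T)..(2*T), (R (u+1) - R u) := by
    have := intervalIntegral.integral_comp_mul_right (a := 1) (b := 2) (fun u => R (u+1) - R u) hT.ne'
    simpa using this
  have e2 : T * (∫ x in (1:ℝ)..2, (R (x*T+1) - R (x*T))) =
      (∫ u in (2*T)..(2*T+1), R u) - ∫ u in (T)..(T+1), R u := by
    rw [e1, ← mul_assoc, mul_inv_cancel₀ hT.ne', one_mul,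
      intervalIntegral.integral_sub (hi1 _ _) (hi _ _),
      intervalIntegral.integral_comp_add_right (fun u => R u) 1]
    have := intervalIntegral.integral_interval_sub_interval_comm (hi (T+1) (2*T+1)) (hi T (2*T)) (hi _ _)
    have h3 := intervalIntegral.integral_symm (μ := MeasureTheory.volume) (f := R) T (T+1)
    have h4 := intervalIntegral.integral_symm (μ := MeasureTheory.volume) (f := R) (2*T) (2*T+1)
    linarith
  have b1 : ∀ a, (∫ u in a..(a+1), R u) ≤ R (a+1) := by
    intro a
    have := intervalIntegral.integral_mono_on (a := a) (b := a+1) (by linarith) (hi a (a+1))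
      (g := fun _ => R (a+1)) (by simp) (fun x hx => hRmono hx.2)
    simpa using this
  have b2 : ∀ a, R a ≤ (∫ u in a..(a+1), R u) := by
    intro a
    have := intervalIntegral.integral_mono_on (a := a) (b := a+1) (by linarith) (f := fun _ => R a)
      (by simp) (hi a (a+1)) (fun x hx => hRmono hx.1)
    simpa using this
  rw [e2]
  constructor
  · linarith [b1 (2*T), b2 T]
  · linarith [b2 (2*T), b1 T]

lemma aux_karamata (R L : ℝ → ℝ) (β : ℝ) (hRmono : Monotone R)
    (hRtop : Tendsto R atTop atTop)
    (hLpos : ∀ᶠ T in atTop, 0 < L T)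
    (hL : ∀ h > 0, Tendsto (fun T => (R (T+h) - R T) / L T) atTop (𝓝 h))
    (hLrv : ∀ c > 0, Tendsto (fun T => L (c*T) / L T) atTop (𝓝 (c^β)))
    (hβ : 0 ≤ β)
    (hR : ∀ c > 0, Tendsto (fun T => R (c*T) / R T) atTop (𝓝 (c^(β+1)))) :
    Tendsto (fun T => T * L T / R T) atTop (𝓝 (β+1)) := by
  set D : ℝ → ℝ := fun T => R (T+1) - R T with hD
  have hD0 : ∀ T, 0 ≤ D T := fun T => sub_nonneg.2 (hRmono (by linarith))
  have hDL : Tendsto (fun T => D T / L T) atTop (𝓝 1) := hL 1 one_pos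
  have hDpos : ∀ᶠ T in atTop, 0 < D T := by
    filter_upwards [hLpos, (hDL).eventually_const_lt (zero_lt_one)] with T h1 h2
    exact (div_pos_iff_of_pos_right h1).1 h2
  have hDmeas : Measurable D := by
    have : Measurable R := hRmono.measurable
    fun_prop
  have hDrv : ∀ c > 0, Tendsto (fun T => D (c*T) / D T) atTop (𝓝 (c^β)) := by
    intro c hc
    have hcT : Tendsto (fun T : ℝ => c * T) atTop atTop := tendsto_id.const_mul_atTop hc
    have h1 := ((hDL.comp hcT).mul (hLrv c hc)).div hDL one_ne_zero
    rw [div_one, one_mul] at h1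
    refine h1.congr' ?_
    filter_upwards [hLpos, hcT.eventually hLpos, hDpos] with T h1 h2 h3
    simp only [Function.comp, Pi.div_apply]
    field_simp
  have hb : 0 < β + 1 := by positivity
  -- upper bound
  have hmin : Tendsto (fun T => ∫ x in (1:ℝ)..2, min (D (x*T) / D T) 1) atTop (𝓝 (∫ x in (1:ℝ)..2, 1)) := by
    refine intervalIntegral.tendsto_integral_filter_of_dominated_convergence (fun _ => 1) ?_ ?_ (by simp) ?_
    · refine Eventually.of_forall fun T => Measurable.aestronglyMeasurable ?_
      fun_prop
    · refine Eventually.of_forall fun T => Eventually.of_forall fun x hx => ?_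
      rw [Real.norm_of_nonneg (le_min (div_nonneg (hD0 _) (hD0 _)) zero_le_one)]
      exact min_le_right _ _
    · refine Eventually.of_forall fun x hx => ?_
      rw [Set.uIoc_of_le (by norm_num)] at hx
      have h1 := (hDrv x (by linarith [hx.1])).min (tendsto_const_nhds (x := (1:ℝ)))
      rwa [min_eq_right (Real.one_le_rpow hx.1.le hβ)] at h1
  have hmin2 : ∀ᶠ T in atTop, 1/2 < ∫ x in (1:ℝ)..2, min (D (x*T) / D T) 1 :=
    hmin.eventually_const_lt (by norm_num)
  have hint : ∀ T > 0, IntervalIntegrable (fun x => D (x*T)) MeasureTheory.volume 1 2 := by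
    intro T hT
    apply IntervalIntegrable.sub
    · have : Monotone (fun x => R (x*T+1)) := fun a b h => hRmono (by gcongr)
      exact this.intervalIntegrable
    · have : Monotone (fun x => R (x*T)) := fun a b h => hRmono (by gcongr)
      exact this.intervalIntegrable
  obtain ⟨C, hC0, hC⟩ : ∃ C > 0, ∀ᶠ T in atTop, T * D T / R T ≤ C := by
    refine ⟨2 * (3^(β+1) + 1), by positivity, ?_⟩
    filter_upwards [hmin2, hDpos, eventually_ge_atTop 1, hRtop.eventually_gt_atTop 0,
      (hR 3 (by norm_num)).eventually_lt_const (lt_add_one _)] with T h1 h2 h3 h4 h5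
    have hT : 0 < T := by linarith
    have i1 : (∫ x in (1:ℝ)..2, min (D (x*T) / D T) 1) ≤ ∫ x in (1:ℝ)..2, D (x*T) / D T := by
      refine intervalIntegral.integral_mono_on (by norm_num) ?_ ((hint T hT).div_const _) (fun x hx => min_le_left _ _)
      rw [intervalIntegrable_iff]
      refine MeasureTheory.Integrable.mono' (g := fun _ => (1:ℝ)) (by simp) (Measurable.aestronglyMeasurable (by fun_prop)) ?_
      refine Eventually.of_forall fun x => ?_
      rw [Real.norm_of_nonneg (le_min (div_nonneg (hD0 _) (hD0 _)) zero_le_one)]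
      exact min_le_right _ _
    rw [intervalIntegral.integral_div] at i1
    have i2 := (aux_intbound R hRmono T hT).1
    have i3 : 1/2 * D T < ∫ x in (1:ℝ)..2, D (x*T) := by
      have := lt_of_lt_of_le h1 i1
      rwa [lt_div_iff₀ h2] at this
    have i4 : R (2*T+1) ≤ R (3*T) := hRmono (by linarith)
    have i5 : R (3*T) < (3^(β+1) + 1) * R T := by rwa [div_lt_iff₀ h4] at h5
    rw [div_le_iff₀ h4]
    have i6 : T * (1/2 * D T) ≤ T * ∫ x in (1:ℝ)..2, D (x*T) := by gcongr
    have i7 : T * (∫ x in (1:ℝ)..2, D (x*T)) ≤ R (2*T+1) - R T := i2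
    nlinarith
  have hR1 : Tendsto (fun T => R (T+1) / R T) atTop (𝓝 1) := by
    have h0 : Tendsto (fun T => D T / R T) atTop (𝓝 0) := by
      have hz : Tendsto (fun T : ℝ => C / T) atTop (𝓝 0) := tendsto_id.const_div_atTop C
      refine tendsto_of_tendsto_of_tendsto_of_le_of_le' tendsto_const_nhds hz ?_ ?_
      · filter_upwards [hRtop.eventually_gt_atTop 0] with T h
        exact div_nonneg (hD0 _) h.le
      · filter_upwards [hC, hRtop.eventually_gt_atTop 0, eventually_gt_atTop 0] with T h1 h h0
        rw [le_div_iff₀ h0]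
        calc _ = T * D T / R T := by ring
          _ ≤ C := h1
    have := h0.const_add 1
    rw [add_zero] at this
    refine this.congr' ?_
    filter_upwards [hRtop.eventually_gt_atTop 0] with T h
    simp only [hD]; field_simp; ring
  have h2T : Tendsto (fun T : ℝ => 2 * T) atTop atTop := tendsto_id.const_mul_atTop (by norm_num)
  have hlimI : Tendsto (fun T => T * (∫ x in (1:ℝ)..2, D (x*T)) / R T) atTop (𝓝 (2^(β+1) - 1)) := by
    have hup : Tendsto (fun T => R (2*T+1) / R (2*T) * (R (2*T) / R T) - 1) atTop (𝓝 (1 * 2^(β+1) - 1)) :=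
      ((hR1.comp h2T).mul (hR 2 (by norm_num))).sub_const 1
    have hlo : Tendsto (fun T => R (2*T) / R T - R (T+1) / R T) atTop (𝓝 (2^(β+1) - 1)) :=
      (hR 2 (by norm_num)).sub hR1
    rw [one_mul] at hup
    refine tendsto_of_tendsto_of_tendsto_of_le_of_le' hlo hup ?_ ?_
    · filter_upwards [hRtop.eventually_gt_atTop 0, eventually_gt_atTop 0] with T h hT
      rw [← sub_div]
      gcongr
      exact (aux_intbound R hRmono T hT).2
    · filter_upwards [hRtop.eventually_gt_atTop 0, eventually_gt_atTop 0, (hRtop.comp h2T).eventually_gt_atTop 0] with T h hT h2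
      simp only [Function.comp] at h2
      have : R (2*T+1) / R (2*T) * (R (2*T) / R T) - 1 = (R (2*T+1) - R T) / R T := by
        field_simp
      rw [this]
      gcongr
      exact (aux_intbound R hRmono T hT).1
  have hdct : Tendsto (fun T => ∫ x in (1:ℝ)..2, (T * D (x*T) / R T - (T * D T / R T) * x^β)) atTop (𝓝 (∫ x in (1:ℝ)..2, 0)) := by
    refine intervalIntegral.tendsto_integral_filter_of_dominated_convergence
      (fun _ => C * (2^(β+1)+1) + C * 2^β) ?_ ?_ (by simp) ?_
    · refine Eventually.of_forall fun T => Measurable.aestronglyMeasurable ?_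
      fun_prop
    · obtain ⟨T0, hT0⟩ := eventually_atTop.1 hC
      filter_upwards [eventually_ge_atTop T0, eventually_gt_atTop 0, hRtop.eventually_gt_atTop 0,
        (hR 2 (by norm_num)).eventually_lt_const (lt_add_one _)] with T h1 h2 h3 h4
      refine Eventually.of_forall fun x hx => ?_
      rw [Set.uIoc_of_le (by norm_num)] at hx
      have hx0 : 0 < x := by linarith [hx.1]
      have hxT : T ≤ x * T := by nlinarith [hx.1]
      have k1 := hT0 (x*T) (by linarith)
      have hRx : 0 < R (x*T) := lt_of_lt_of_le h3 (hRmono hxT)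
      have k2 : T * D (x*T) / R T ≤ C * (2^(β+1)+1) := by
        have q1 : R (x*T) / R T ≤ 2^(β+1)+1 := by
          refine le_trans ?_ h4.le
          gcongr
          exact hRmono (by nlinarith [hx.2])
        have q2 : T * D (x*T) / R (x*T) ≤ C := by
          refine le_trans ?_ k1
          gcongr
          exact hD0 _
        calc T * D (x*T) / R T = (T * D (x*T) / R (x*T)) * (R (x*T) / R T) := (div_mul_div_cancel₀ hRx.ne').symm
          _ ≤ _ := mul_le_mul q2 q1 (by positivity) hC0.le
      have k3 : T * D T / R T * x^β ≤ C * 2^β := by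
        refine mul_le_mul (hT0 T h1) (Real.rpow_le_rpow hx0.le hx.2 hβ) (by positivity) hC0.le
      have k4 : 0 ≤ T * D (x*T) / R T := div_nonneg (mul_nonneg h2.le (hD0 _)) h3.le
      have k5 : 0 ≤ T * D T / R T * x^β := mul_nonneg (div_nonneg (mul_nonneg h2.le (hD0 _)) h3.le) (by positivity)
      rw [Real.norm_eq_abs, abs_le]
      constructor <;> linarith
    · refine Eventually.of_forall fun x hx => ?_
      rw [Set.uIoc_of_le (by norm_num)] at hx
      have hx0 : 0 < x := by linarith [hx.1]
      have h1 : Tendsto (fun T => D (x*T) / D T - x^β) atTop (𝓝 0) := by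
        have := (hDrv x hx0).sub_const (x^β)
        rwa [sub_self] at this
      have h2 : Tendsto (fun T => (T * D T / R T) * (D (x*T) / D T - x^β)) atTop (𝓝 0) := by
        refine bdd_le_mul_tendsto_zero' C ?_ h1
        filter_upwards [hC, eventually_gt_atTop 0, hRtop.eventually_gt_atTop 0] with T q1 q2 q3
        rwa [abs_of_nonneg (div_nonneg (mul_nonneg q2.le (hD0 _)) q3.le)]
      refine h2.congr' ?_
      filter_upwards [hDpos] with T q
      field_simp
  have hfin : Tendsto (fun T => T * D T / R T) atTop (𝓝 (β+1)) := by
    clear_value D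
    rw [intervalIntegral.integral_zero] at hdct
    have h21 : (0:ℝ) < 2^(β+1) - 1 := by
      have := Real.one_lt_rpow (x := 2) (by norm_num) hb
      linarith
    have h1 := (hlimI.sub hdct).mul_const ((β+1) / (2^(β+1) - 1))
    rw [sub_zero, mul_div_cancel₀ _ h21.ne'] at h1
    refine h1.congr' ?_
    filter_upwards [eventually_gt_atTop 0] with T hT
    rw [intervalIntegral.integral_sub, intervalIntegral.integral_const_mul, integral_rpow (by left; linarith),
      intervalIntegral.integral_div, intervalIntegral.integral_const_mul, Real.one_rpow]
    · field_simp
      ring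
    · exact ((hint T hT).const_mul _).div_const _
    · apply IntervalIntegrable.const_mul
      exact intervalIntegral.intervalIntegrable_rpow' (by linarith)
  have := hfin.div hDL one_ne_zero
  rw [div_one] at this
  refine this.congr' ?_
  filter_upwards [hDpos, hLpos] with T h1 h2
  simp only [Pi.div_apply]
  field_simp

lemma aux_doubling (ρ g : ℝ → ℝ) (hmono : MonotoneOn ρ (Set.Ioi 0)) (hρ0 : ∀ x, 0 ≤ ρ x)
    (hg : ∀ᶠ t in atTop, 0 < g t)
    (h6 : ∀ lam > 0, Tendsto (fun t => (ρ (lam * t) - ρ t) / g t) atTop (𝓝 (Real.log lam))) :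
    ∃ M > 0, ∃ y0 > 0, ∀ t ≥ y0, ∀ x > 0,
      ρ (2*(t/x)) - ρ (t/x) ≤ M * (x^((1:ℝ)/2) + x^(-(1:ℝ)/2)) * (ρ (2*t) - ρ t) := by
  set D : ℝ → ℝ := fun y => ρ (2*y) - ρ y with hD
  have hl2 : 0 < Real.log 2 := Real.log_pos (by norm_num)
  have hDg : Tendsto (fun t => D t / g t) atTop (𝓝 (Real.log 2)) := h6 2 (by norm_num)
  have hDpos : ∀ᶠ t in atTop, 0 < D t := by
    filter_upwards [hg, hDg.eventually_const_lt hl2] with T h1 h2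
    exact (div_pos_iff_of_pos_right h1).1 h2
  have hDD : Tendsto (fun t => D (2*t) / D t) atTop (𝓝 1) := by
    have h1 := ((h6 4 (by norm_num)).sub (h6 2 (by norm_num))).div hDg hl2.ne'
    have : Real.log 4 = 2 * Real.log 2 := by
      rw [show (4:ℝ) = 2^2 by norm_num, Real.log_pow]; norm_num
    rw [this, show (2 * Real.log 2 - Real.log 2) / Real.log 2 = 1 by field_simp; norm_num] at h1
    refine h1.congr' ?_
    filter_upwards [hg, hDpos] with t h2 h3
    simp only [Pi.div_apply]
    rw [← sub_div, div_div_div_cancel_right₀ h2.ne']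
    simp only [hD]
    congr 1
    rw [← mul_assoc]; norm_num
  have hs : (1:ℝ) < √2 := by
    rw [Real.lt_sqrt] <;> norm_num
  have hs2 : √2 ≤ (2:ℝ) := by
    rw [Real.sqrt_le_left] <;> norm_num
  have hss : √2 * √2 = (2:ℝ) := Real.mul_self_sqrt (by norm_num)
  obtain ⟨y0, hy0⟩ := eventually_atTop.1 (((hDpos.and (hDD.eventually_lt_const hs)).and
    (hDD.eventually_const_lt (show (1/√2:ℝ) < 1 by rw [div_lt_one] <;> linarith))).and (eventually_gt_atTop (0:ℝ)))
  have hy0p : 0 < y0 := (hy0 y0 le_rfl).2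
  have P : ∀ y ≥ y0, 0 < D y := fun y hy => (hy0 y hy).1.1.1
  have U : ∀ y ≥ y0, D (2*y) ≤ √2 * D y := fun y hy => by
    have := (hy0 y hy).1.1.2
    rw [div_lt_iff₀ (P y hy)] at this
    exact this.le
  have Dn : ∀ y ≥ y0, D y ≤ √2 * D (2*y) := fun y hy => by
    have := (hy0 y hy).1.2
    rw [div_lt_div_iff₀ (by linarith) (P y hy)] at this
    linarith
  have hpow : ∀ n : ℕ, ∀ y ≥ y0, y0 ≤ 2^n * y := by
    intro n y hy
    have : (1:ℝ) ≤ 2^n := one_le_pow₀ (by norm_num)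
    nlinarith
  have Un : ∀ n : ℕ, ∀ y ≥ y0, D (2^n*y) ≤ √2^n * D y := by
    intro n y hy
    induction n with
    | zero => simp
    | succ n ih =>
      calc D (2^(n+1)*y) = D (2*(2^n*y)) := by ring_nf
        _ ≤ √2 * D (2^n*y) := U _ (hpow n y hy)
        _ ≤ √2 * (√2^n * D y) := by gcongr
        _ = _ := by ring
  have Dnn : ∀ n : ℕ, ∀ y ≥ y0, D y ≤ √2^n * D (2^n*y) := by
    intro n y hy
    induction n with
    | zero => simp
    | succ n ih =>
      calc D y ≤ √2^n * D (2^n*y) := ih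
        _ ≤ √2^n * (√2 * D (2*(2^n*y))) := by gcongr; exact Dn _ (hpow n y hy)
        _ = √2^(n+1) * D (2^(n+1)*y) := by ring_nf
  have hn : ∀ y ≥ y0, ∀ z ≥ y, ∃ n : ℕ, 2^n * y ≤ z ∧ z < 2^(n+1) * y ∧ √2^n ≤ √(z/y) := by
    intro y hy z hz
    have hyp : 0 < y := by linarith
    obtain ⟨n, h1, h2⟩ := exists_nat_pow_near (x := z/y) (y := (2:ℝ)) (by rwa [le_div_iff₀ hyp, one_mul]) (by norm_num)
    refine ⟨n, (le_div_iff₀ hyp).1 h1, (div_lt_iff₀ hyp).1 h2, ?_⟩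
    apply Real.le_sqrt_of_sq_le
    rw [← pow_mul, mul_comm n 2, pow_mul, Real.sq_sqrt (by norm_num)]
    exact h1
  have B1 : ∀ y ≥ y0, ∀ z ≥ y, ∀ n : ℕ, 2^n * y ≤ z → z < 2^(n+1) * y → D z ≤ 3 * √2^n * D y := by
    intro y hy z hz n h1 h2
    have hyp : 0 < y := by linarith
    have m1 : ρ (2*z) ≤ ρ (2 * (2^(n+1)*y)) := hmono (Set.mem_Ioi.2 (by linarith)) (Set.mem_Ioi.2 (by positivity)) (by linarith)
    have m2 : ρ (2^n*y) ≤ ρ z := hmono (Set.mem_Ioi.2 (by positivity)) (Set.mem_Ioi.2 (by linarith)) h1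
    have m3 : D (2^n*y) + D (2^(n+1)*y) = ρ (2 * (2^(n+1)*y)) - ρ (2^n*y) := by
      simp only [hD]; rw [show 2 * (2^n*y) = 2^(n+1)*y by ring]; ring
    have m4 := Un n y hy
    have m5 := Un (n+1) y hy
    have : D z ≤ √2^n * D y + √2^(n+1) * D y := by
      simp only [hD] at *; linarith
    have h3 : 0 < √2^n * D y := mul_pos (by positivity) (P y hy)
    rw [pow_succ] at this
    nlinarith
  have B1' : ∀ y ≥ y0, ∀ z ≥ y, D z ≤ 6 * √(z/y) * D y := by
    intro y hy z hz
    obtain ⟨n, h1, h2, h3⟩ := hn y hy z hz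
    have h4 := B1 y hy z hz n h1 h2
    have := P y hy
    calc D z ≤ 3 * √2^n * D y := h4
      _ ≤ 6 * √(z/y) * D y := by gcongr; norm_num
  have B2 : ∀ y ≥ y0, ∀ z ≥ y, D y ≤ 6 * √(z/y) * D z := by
    intro y hy z hz
    obtain ⟨n, h1, h2, h3⟩ := hn y hy z hz
    have hzp := P z (by linarith)
    have k1 := Dnn (n+1) y hy
    have k2 : D (2^(n+1)*y) ≤ 3 * √2 * D z := by
      by_cases hc : 2^(n+1)*y < 2 * z
      · have := B1 z (by linarith) (2^(n+1)*y) h2.le 0 (by simpa using h2.le) (by simpa using hc)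
        rw [pow_zero, mul_one] at this
        refine this.trans ?_
        gcongr; linarith
      · have : 2^(n+1)*y = 2*z := by
          rw [pow_succ] at hc ⊢; linarith
        rw [this]
        refine (U z (by linarith)).trans ?_
        gcongr; linarith
    calc D y ≤ √2^(n+1) * (3 * √2 * D z) := k1.trans (by gcongr)
      _ = (√2 * √2) * 3 * √2^n * D z := by ring
      _ = 6 * √2^n * D z := by rw [hss]; ring
      _ ≤ _ := by gcongr
  refine ⟨6 + 6 * ρ (2*y0) / D y0, by have := P y0 le_rfl; have := hρ0 (2*y0); positivity, y0, hy0p, ?_⟩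
  intro t ht x hx
  change D (t/x) ≤ _ * D t
  have htp : 0 < t := by linarith
  have hDt := P t ht
  have hDy := P y0 le_rfl
  have hM : 0 ≤ 6 * ρ (2*y0) / D y0 := by have := hρ0 (2*y0); positivity
  have e1 : x^((1:ℝ)/2) = √x := (Real.sqrt_eq_rpow x).symm
  have e2 : x^(-(1:ℝ)/2) = √(1/x) := by
    rw [Real.sqrt_eq_rpow, one_div, Real.inv_rpow hx.le, neg_div, Real.rpow_neg hx.le]
  rw [e1, e2]
  by_cases hc : y0 ≤ t/x
  · have : D (t/x) ≤ 6 * (√x + √(1/x)) * D t := by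
      rcases le_total 1 x with h | h
      · have hle : t/x ≤ t := div_le_self htp.le h
        have := B2 (t/x) hc t hle
        rw [show t/(t/x) = x by field_simp] at this
        refine this.trans ?_
        gcongr
        linarith [Real.sqrt_nonneg (1/x)]
      · have hle : t ≤ t/x := by rw [le_div_iff₀ hx]; nlinarith
        have := B1' t ht (t/x) hle
        rw [show t/x/t = 1/x by field_simp] at this
        refine this.trans ?_
        gcongr
        linarith [Real.sqrt_nonneg (x)]
    refine this.trans ?_
    gcongr
    linarith
  · push Not at hc
    have k1 : D (t/x) ≤ ρ (2*y0) := by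
      have : ρ (2*(t/x)) ≤ ρ (2*y0) := hmono (Set.mem_Ioi.2 (by positivity)) (Set.mem_Ioi.2 (by positivity)) (by linarith)
      have := hρ0 (t/x)
      simp only [hD]; linarith
    have k2 : D y0 ≤ 6 * √x * D t := by
      refine (B2 y0 le_rfl t ht).trans ?_
      gcongr
      rw [div_lt_iff₀ hx] at hc
      rw [div_le_iff₀ hy0p]; linarith
    calc D (t/x) ≤ ρ (2*y0) / D y0 * D y0 := by rw [div_mul_cancel₀ _ hDy.ne']; exact k1
      _ ≤ ρ (2*y0) / D y0 * (6 * √x * D t) := by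
        have := hρ0 (2*y0)
        gcongr
      _ = (6 * ρ (2*y0) / D y0) * √x * D t := by ring
      _ ≤ _ := by
        gcongr
        · linarith
        · linarith [Real.sqrt_nonneg (1/x)]

lemma aux_dct1 (ρ g : ℝ → ℝ) (hmono : MonotoneOn ρ (Set.Ioi 0)) (hρ0 : ∀ x, 0 ≤ ρ x)
    (hg : ∀ᶠ t in atTop, 0 < g t)
    (h6 : ∀ lam > 0, Tendsto (fun t => (ρ (lam * t) - ρ t) / g t) atTop (𝓝 (Real.log lam))) :
    Tendsto (fun t => (∫ x in Set.Ioi (0:ℝ), Real.exp (-x) * (ρ (2*(t/x)) - ρ (t/x))) / g t) atTop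
      (𝓝 (Real.log 2)) := by
  obtain ⟨M, hM, y0, hy0, hb⟩ := aux_doubling ρ g hmono hρ0 hg h6
  have hl2 : Real.log 2 < 1 := by have := Real.log_two_lt_d9; linarith
  have hlim : ∫ x in Set.Ioi (0:ℝ), Real.exp (-x) * Real.log 2 = Real.log 2 := by
    rw [MeasureTheory.integral_mul_const, integral_exp_neg_Ioi_zero, one_mul]
  simp only [← MeasureTheory.integral_div]
  rw [← hlim]
  refine MeasureTheory.tendsto_integral_filter_of_dominated_convergence
    (fun x => M * (Real.exp (-x) * x^((3:ℝ)/2 - 1) + Real.exp (-x) * x^((1:ℝ)/2-1))) ?_ ?_ ?_ ?_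
  · filter_upwards [eventually_gt_atTop 0] with t ht
    apply AEMeasurable.aestronglyMeasurable
    apply AEMeasurable.div_const
    apply AEMeasurable.mul (by fun_prop)
    apply AEMeasurable.sub
    · apply aemeasurable_restrict_of_antitoneOn measurableSet_Ioi
      intro a ha b hb hab
      rw [Set.mem_Ioi] at ha hb
      exact hmono (Set.mem_Ioi.2 (by positivity)) (Set.mem_Ioi.2 (by positivity)) (by gcongr)
    · apply aemeasurable_restrict_of_antitoneOn measurableSet_Ioi
      intro a ha b hb hab
      rw [Set.mem_Ioi] at ha hb
      exact hmono (Set.mem_Ioi.2 (by positivity)) (Set.mem_Ioi.2 (by positivity)) (by gcongr)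
  · filter_upwards [eventually_ge_atTop y0, hg, (h6 2 (by norm_num)).eventually_lt_const hl2] with t ht hgt h2
    rw [MeasureTheory.ae_restrict_iff' measurableSet_Ioi]
    refine Eventually.of_forall fun x hx => ?_
    rw [Set.mem_Ioi] at hx
    have htp : 0 < t := by linarith
    have h3 := hb t ht x hx
    have h4 : 0 ≤ ρ (2*(t/x)) - ρ (t/x) := by
      refine sub_nonneg.2 (hmono (Set.mem_Ioi.2 (by positivity)) (Set.mem_Ioi.2 (by positivity)) ?_)
      have : 0 < t/x := by positivity
      linarith
    rw [Real.norm_of_nonneg (by positivity), div_le_iff₀ hgt]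
    rw [div_lt_one hgt] at h2
    have e1 : (3:ℝ)/2 - 1 = 1/2 := by norm_num
    have e2 : (1:ℝ)/2 - 1 = -1/2 := by norm_num
    rw [e1, e2]
    calc _ ≤ Real.exp (-x) * (M * (x^((1:ℝ)/2) + x^(-(1:ℝ)/2)) * g t) := by
          gcongr
          refine h3.trans ?_
          gcongr
      _ = _ := by ring
  · exact ((Real.GammaIntegral_convergent (s := 3/2) (by norm_num)).add
      (Real.GammaIntegral_convergent (s := 1/2) (by norm_num))).const_mul M
  · rw [MeasureTheory.ae_restrict_iff' measurableSet_Ioi]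
    refine Eventually.of_forall fun x hx => ?_
    rw [Set.mem_Ioi] at hx
    have h1 := ((h6 (2/x) (by positivity)).sub (h6 (1/x) (by positivity))).const_mul (Real.exp (-x))
    rw [Real.log_div two_ne_zero hx.ne', Real.log_div one_ne_zero hx.ne', Real.log_one] at h1
    rw [show Real.log 2 - Real.log x - (0 - Real.log x) = Real.log 2 by ring] at h1
    refine h1.congr fun t => ?_
    rw [← sub_div, show 2 / x * t = 2 * (t/x) by ring, show 1/x*t = t/x by ring]
    ring

lemma aux_summable (p : ℕ → ℝ) (hp1 : ∑' k, p k = 1) : Summable p := by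
  by_contra h
  rw [tsum_eq_zero_of_not_summable h] at hp1
  exact zero_ne_one hp1

lemma aux_rho_finset (p : ℕ → ℝ) (hs : Summable p) (x : ℝ) (hx : 0 < x) :
    ∃ S : Finset ℕ, (∀ k, k ∈ S ↔ 1/x ≤ p k) ∧ rhoJ p 1 x = S.card := by
  have hfin : {k | 1/x ≤ p k}.Finite := by
    have h1 := hs.tendsto_cofinite_zero.eventually_lt_const (show (0:ℝ) < 1/x by positivity)
    rw [eventually_cofinite] at h1
    simpa using h1
  refine ⟨hfin.toFinset, by simp, ?_⟩
  unfold rhoJ prodP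
  have e : {r : Fin 1 → ℕ // 1 / x ≤ ∏ i, p (r i)} ≃ {k | 1/x ≤ p k} :=
    (Equiv.funUnique (Fin 1) ℕ).subtypeEquiv (by intro a; simp)
  rw [Nat.card_congr e, Nat.card_coe_set_eq, Set.ncard_eq_toFinset_card _ hfin]

lemma aux_hasSum_rho (p : ℕ → ℝ) (hs : Summable p) (x : ℝ) (hx : 0 < x) :
    HasSum (fun k => if 1/x ≤ p k then (1:ℝ) else 0) (rhoJ p 1 x) := by
  obtain ⟨S, hS, hc⟩ := aux_rho_finset p hs x hx
  rw [hc]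
  have : (S.card : ℝ) = ∑ k ∈ S, (if 1/x ≤ p k then (1:ℝ) else 0) := by
    rw [Finset.sum_congr rfl (fun k hk => if_pos ((hS k).1 hk))]; simp
  rw [this]
  apply hasSum_sum_of_ne_finset_zero
  intro k hk
  rw [hS] at hk
  exact if_neg hk

lemma aux_rho_nonneg (p : ℕ → ℝ) (j : ℕ) (x : ℝ) : 0 ≤ rhoJ p j x := by
  unfold rhoJ; positivity

lemma aux_rho_mono (p : ℕ → ℝ) (hs : Summable p) : MonotoneOn (rhoJ p 1) (Set.Ioi 0) := by
  intro x hx y hy hxy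
  rw [Set.mem_Ioi] at hx hy
  refine hasSum_le (fun k => ?_) (aux_hasSum_rho p hs x hx) (aux_hasSum_rho p hs y hy)
  have : 1/y ≤ 1/x := by gcongr
  split_ifs with h1 h2 <;> first | (exfalso; linarith) | norm_num

lemma aux_rho_top (p : ℕ → ℝ) (hs : Summable p) (hpinf : {k | 0 < p k}.Infinite) :
    Tendsto (rhoJ p 1) atTop atTop := by
  rw [tendsto_atTop]
  intro b
  obtain ⟨n, hn⟩ := exists_nat_ge b
  obtain ⟨s, hs1, hs2⟩ := hpinf.exists_subset_card_eq n
  have h1 : ∀ k ∈ s, ∀ᶠ x in atTop, 1/x ≤ p k := by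
    intro k hk
    have hk : 0 < p k := hs1 hk
    have : Tendsto (fun x : ℝ => 1/x) atTop (𝓝 0) := tendsto_id.const_div_atTop 1
    exact (this.eventually_lt_const hk).mono fun x h => h.le
  filter_upwards [(Filter.eventually_all_finset s).2 h1, eventually_gt_atTop 0] with x hx hx0
  obtain ⟨S, hS, hc⟩ := aux_rho_finset p hs x hx0
  rw [hc]
  refine hn.trans ?_
  rw [← hs2]
  exact_mod_cast Finset.card_le_card (fun k hk => (hS k).2 (hx k hk))

/-- kernel -/
noncomputable def kapK (x : ℝ) : ℝ := Real.exp (-x) - Real.exp (-(2*x))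

lemma kapK_nonneg {x : ℝ} (hx : 0 ≤ x) : 0 ≤ kapK x := by
  unfold kapK
  rw [sub_nonneg, Real.exp_le_exp]; linarith

lemma kapK_le {x : ℝ} (hx : 0 ≤ x) : kapK x ≤ x := by
  unfold kapK
  have h1 : Real.exp (-(2*x)) = Real.exp (-x) * Real.exp (-x) := by rw [← Real.exp_add]; ring_nf
  have h2 : 1 - x ≤ Real.exp (-x) := by have := Real.add_one_le_exp (-x); linarith
  have h3 : Real.exp (-x) ≤ 1 := Real.exp_le_one_iff.2 (by linarith)
  have h4 := Real.exp_pos (-x)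
  rw [h1]
  nlinarith

lemma le_kapK {x : ℝ} (hx : 0 ≤ x) (hx1 : x ≤ 1) : x ≤ 9 * kapK x := by
  unfold kapK
  have h1 : Real.exp (-(2*x)) = Real.exp (-x) * Real.exp (-x) := by rw [← Real.exp_add]; ring_nf
  have h4 := Real.exp_pos (-x)
  have h5 : Real.exp (-x) * Real.exp x = 1 := by rw [← Real.exp_add]; simp
  have h6 : Real.exp x ≤ Real.exp 1 := Real.exp_le_exp.2 hx1
  have h7 := Real.exp_one_lt_three
  have h8 := Real.add_one_le_exp x
  -- e^{-x} ≥ 1/3, 1 - e^{-x} = e^{-x}(e^x - 1) ≥ x/3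
  have h9 : 1/3 ≤ Real.exp (-x) := by nlinarith
  have h10 : x/3 ≤ 1 - Real.exp (-x) := by nlinarith
  rw [h1]
  have : 1/3 * (x/3) ≤ Real.exp (-x) * (1 - Real.exp (-x)) := by gcongr
  linarith

lemma aux_f1_integral (p : ℕ → ℝ) (hp0 : ∀ k, 0 ≤ p k) (hs : Summable p) (t : ℝ) (ht : 0 < t) :
    ∑' k, kapK (t * p k) =
      ∫ x in Set.Ioi (0:ℝ), Real.exp (-x) * (rhoJ p 1 (2*(t/x)) - rhoJ p 1 (t/x)) := by
  set G : ℕ → ℝ → ℝ := fun k => Set.indicator (Set.Ioc (t * p k) (2 * (t * p k))) (fun x => Real.exp (-x)) with hG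
  have hexp : ∀ a b : ℝ, ∫ x in a..b, Real.exp (-x) = Real.exp (-a) - Real.exp (-b) := by
    intro a b
    rw [intervalIntegral.integral_comp_neg (fun x => Real.exp x), integral_exp]
  have htp : ∀ k, 0 ≤ t * p k := fun k => mul_nonneg ht.le (hp0 k)
  have hGi : ∀ k, MeasureTheory.Integrable (G k) (MeasureTheory.volume.restrict (Set.Ioi 0)) := by
    intro k
    apply MeasureTheory.Integrable.integrableOn
    rw [MeasureTheory.integrable_indicator_iff measurableSet_Ioc]
    exact (Continuous.integrableOn_Icc (by fun_prop)).mono_set Set.Ioc_subset_Icc_self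
  have hGint : ∀ k, ∫ x in Set.Ioi (0:ℝ), G k x = kapK (t * p k) := by
    intro k
    rw [MeasureTheory.integral_indicator measurableSet_Ioc,
      MeasureTheory.Measure.restrict_restrict measurableSet_Ioc]
    have : Set.Ioc (t * p k) (2 * (t * p k)) ∩ Set.Ioi 0 = Set.Ioc (t * p k) (2 * (t * p k)) := by
      apply Set.inter_eq_left.2
      intro x hx
      exact lt_of_le_of_lt (htp k) hx.1
    rw [this, ← intervalIntegral.integral_of_le (by linarith [htp k]), hexp]
    rfl
  have hGn : ∀ k x, 0 ≤ G k x := fun k x => Set.indicator_nonneg (fun x _ => (Real.exp_pos _).le) x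
  have hsum : Summable fun k => ∫ x in Set.Ioi (0:ℝ), ‖G k x‖ := by
    have : (fun k => ∫ x in Set.Ioi (0:ℝ), ‖G k x‖) = fun k => kapK (t * p k) := by
      funext k
      rw [← hGint k]
      congr 1
      funext x
      exact Real.norm_of_nonneg (hGn k x)
    rw [this]
    exact Summable.of_nonneg_of_le (fun k => kapK_nonneg (htp k)) (fun k => kapK_le (htp k)) (hs.mul_left t)
  have h1 := (MeasureTheory.hasSum_integral_of_summable_integral_norm hGi hsum).tsum_eq
  simp only [hGint] at h1
  rw [h1]
  apply MeasureTheory.setIntegral_congr_fun measurableSet_Ioi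
  intro x hx
  rw [Set.mem_Ioi] at hx
  have h2 := ((aux_hasSum_rho p hs (2*(t/x)) (by positivity)).sub (aux_hasSum_rho p hs (t/x) (by positivity))).mul_left (Real.exp (-x))
  simp only
  rw [← h2.tsum_eq]
  congr 1
  funext k
  have e1 : 1/(2*(t/x)) ≤ p k ↔ x ≤ 2 * (t * p k) := by
    rw [show 1/(2*(t/x)) = x/(2*t) by field_simp, div_le_iff₀ (by positivity)]
    constructor <;> intro h <;> linarith
  have e2 : 1/(t/x) ≤ p k ↔ x ≤ t * p k := by
    rw [show 1/(t/x) = x/t by field_simp, div_le_iff₀ (by positivity)]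
    constructor <;> intro h <;> linarith
  simp only [hG, Set.indicator_apply, Set.mem_Ioc, e1, e2]
  have := htp k
  split_ifs with a b c d e f <;> first | (simp; done) | (exfalso; rcases a with ⟨a, a'⟩; linarith) | (exfalso; apply a; constructor <;> linarith)

/-- generation sums -/
noncomputable def fJ (p : ℕ → ℝ) (j : ℕ) (t : ℝ) : ℝ := ∑' r : Fin j → ℕ, kapK (t * prodP p j r)

lemma prodP_cons (p : ℕ → ℝ) (j : ℕ) (k : ℕ) (r : Fin j → ℕ) :
    prodP p (j+1) (Fin.cons k r) = p k * prodP p j r := by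
  unfold prodP; rw [Fin.prod_univ_succ]; simp

lemma prodP_nonneg (p : ℕ → ℝ) (hp0 : ∀ k, 0 ≤ p k) (j : ℕ) (r : Fin j → ℕ) : 0 ≤ prodP p j r :=
  Finset.prod_nonneg fun _ _ => hp0 _

lemma aux_prod_hasSum (p : ℕ → ℝ) (hp0 : ∀ k, 0 ≤ p k) (h : HasSum p 1) (j : ℕ) :
    HasSum (prodP p j) 1 := by
  induction j with
  | zero =>
    have : prodP p 0 = fun _ => 1 := by funext r; simp [prodP]
    rw [this]
    simp
  | succ j ih =>
    rw [← (Fin.consEquiv (fun _ : Fin (j+1) => ℕ)).hasSum_iff]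
    have h1 := h.mul ih (h.summable.mul_of_nonneg ih.summable hp0 (prodP_nonneg p hp0 j))
    rw [one_mul] at h1
    have e' : (prodP p (j+1)) ∘ (Fin.consEquiv (fun _ : Fin (j+1) => ℕ)) =
        fun x : ℕ × (Fin j → ℕ) => p x.1 * prodP p j x.2 := funext fun x => prodP_cons p j x.1 x.2
    rw [e']
    exact h1

lemma aux_fJ_summable (p : ℕ → ℝ) (hp0 : ∀ k, 0 ≤ p k) (h : HasSum p 1) (j : ℕ) (t : ℝ) (ht : 0 ≤ t) :
    Summable fun r : Fin j → ℕ => kapK (t * prodP p j r) :=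
  Summable.of_nonneg_of_le (fun r => kapK_nonneg (mul_nonneg ht (prodP_nonneg p hp0 j r)))
    (fun r => kapK_le (mul_nonneg ht (prodP_nonneg p hp0 j r)))
    ((aux_prod_hasSum p hp0 h j).summable.mul_left t)

lemma aux_fJ_nonneg (p : ℕ → ℝ) (hp0 : ∀ k, 0 ≤ p k) (j : ℕ) (t : ℝ) (ht : 0 ≤ t) : 0 ≤ fJ p j t :=
  tsum_nonneg fun r => kapK_nonneg (mul_nonneg ht (prodP_nonneg p hp0 j r))

lemma aux_fJ_le (p : ℕ → ℝ) (hp0 : ∀ k, 0 ≤ p k) (h : HasSum p 1) (j : ℕ) (t : ℝ) (ht : 0 ≤ t) :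
    fJ p j t ≤ t := by
  have h1 := (aux_prod_hasSum p hp0 h j).mul_left t
  rw [mul_one] at h1
  exact hasSum_le (fun r => kapK_le (mul_nonneg ht (prodP_nonneg p hp0 j r)))
    (aux_fJ_summable p hp0 h j t ht).hasSum h1

lemma aux_fJ_succ (p : ℕ → ℝ) (hp0 : ∀ k, 0 ≤ p k) (h : HasSum p 1) (j : ℕ) (t : ℝ) (ht : 0 ≤ t) :
    fJ p (j+1) t = ∑' k, fJ p j (t * p k) := by
  have h1 := aux_fJ_summable p hp0 h (j+1) t ht
  unfold fJ
  rw [← (Fin.consEquiv (fun _ : Fin (j+1) => ℕ)).tsum_eq]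
  rw [← (Fin.consEquiv (fun _ : Fin (j+1) => ℕ)).summable_iff] at h1
  have e : ∀ x : ℕ × (Fin j → ℕ), kapK (t * prodP p (j+1) ((Fin.consEquiv (fun _ : Fin (j+1) => ℕ)) x)) =
      kapK (t * p x.1 * prodP p j x.2) := by
    intro x
    rw [mul_assoc]
    congr 2
    exact prodP_cons p j x.1 x.2
  have e' : ((fun r => kapK (t * prodP p (j+1) r)) ∘ (Fin.consEquiv (fun _ : Fin (j+1) => ℕ))) =
      fun x : ℕ × (Fin j → ℕ) => kapK (t * p x.1 * prodP p j x.2) := funext e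
  rw [e'] at h1
  rw [tsum_congr e]
  exact h1.tsum_prod

lemma aux_fJ_one (p : ℕ → ℝ) (t : ℝ) : fJ p 1 t = ∑' k, kapK (t * p k) := by
  unfold fJ
  rw [← (Equiv.funUnique (Fin 1) ℕ).symm.tsum_eq]
  simp [prodP]

lemma aux_Phi (p : ℕ → ℝ) (hp0 : ∀ k, 0 ≤ p k) (h : HasSum p 1) (j : ℕ) (t : ℝ) (ht : 0 ≤ t) :
    PhiJ p j (2*t) - PhiJ p j t = fJ p j t := by
  have hsum : ∀ t ≥ 0, Summable fun r : Fin j → ℕ => (1 - Real.exp (-t * prodP p j r)) := by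
    intro t ht
    refine Summable.of_nonneg_of_le (fun r => ?_) (fun r => ?_)
      ((aux_prod_hasSum p hp0 h j).summable.mul_left t)
    · have := mul_nonneg ht (prodP_nonneg p hp0 j r)
      rw [sub_nonneg, Real.exp_le_one_iff]; linarith
    · have := Real.add_one_le_exp (-t * prodP p j r); linarith
  unfold PhiJ fJ
  rw [← (hsum (2*t) (by positivity)).tsum_sub (hsum t ht)]
  congr 1
  funext r
  unfold kapK
  ring_nf

lemma aux_beta_int (a b : ℝ) (ha : 0 < a) (hb : 0 < b) :
    ∫ y in Set.Ioc (0:ℝ) 1, a * y^(a-1) * (1-y)^b =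
      Real.Gamma (a+1) * Real.Gamma (b+1) / Real.Gamma (a+b+1) := by
  have h1 := ProbabilityTheory.beta_eq_betaIntegralReal a (b+1) ha (by linarith)
  have h2 : Complex.betaIntegral a ((b+1 : ℝ) : ℂ) = ((∫ y in (0:ℝ)..1, y^(a-1) * (1-y)^b : ℝ) : ℂ) := by
    unfold Complex.betaIntegral
    rw [← intervalIntegral.integral_ofReal]
    apply intervalIntegral.integral_congr
    intro y hy
    rw [Set.uIcc_of_le zero_le_one] at hy
    simp only
    rw [Complex.ofReal_mul, Complex.ofReal_cpow hy.1, Complex.ofReal_cpow (by linarith [hy.2])]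
    push_cast
    congr 2
    ring
  rw [h2, Complex.ofReal_re] at h1
  have h3 : ∫ y in Set.Ioc (0:ℝ) 1, a * y^(a-1) * (1-y)^b = a * ∫ y in (0:ℝ)..1, y^(a-1) * (1-y)^b := by
    rw [intervalIntegral.integral_of_le zero_le_one, ← MeasureTheory.integral_const_mul]
    simp only [mul_assoc]
  rw [h3, ← h1, ProbabilityTheory.beta, Real.Gamma_add_one ha.ne', add_assoc]
  ring

lemma aux_beta_sum (p : ℕ → ℝ) (R : ℝ → ℝ) (S : ℝ → Finset ℕ) (hp : ∀ k, p k ≤ 1)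
    (hS : ∀ T k, k ∈ S T ↔ Real.exp (-T) ≤ p k) (hRS : ∀ T, R T = (S T).card)
    (hRmono : Monotone R) (hRtop : Tendsto R atTop atTop) (b : ℝ) (hb : 0 < b)
    (hR : ∀ c > 0, Tendsto (fun T => R (c*T) / R T) atTop (𝓝 (c^b))) (a : ℝ) (ha : 0 ≤ a) :
    Tendsto (fun T => (∑ k ∈ S T, (1 + Real.log (p k) / T)^a) / R T) atTop
      (𝓝 (Real.Gamma (a+1) * Real.Gamma (b+1) / Real.Gamma (a+b+1))) := by
  rcases ha.eq_or_lt with rfl | ha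
  · simp only [Real.rpow_zero, Finset.sum_const, nsmul_eq_mul, mul_one, zero_add, Real.Gamma_one, one_mul]
    rw [div_self (Real.Gamma_pos_of_pos (by linarith)).ne']
    refine tendsto_const_nhds.congr' ?_
    filter_upwards [hRtop.eventually_gt_atTop 0] with T hT
    rw [← hRS, div_self hT.ne']
  have hrep : ∀ T > 0, (∑ k ∈ S T, (1 + Real.log (p k) / T)^a) =
      ∫ y in Set.Ioc (0:ℝ) 1, a * y^(a-1) * R (T * (1-y)) := by
    intro T hT
    have hii : MeasureTheory.IntegrableOn (fun y : ℝ => a * y^(a-1)) (Set.Ioc 0 1) := by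
      have := (intervalIntegral.intervalIntegrable_rpow' (a := 0) (b := 1) (r := a-1) (by linarith)).const_mul a
      rwa [intervalIntegrable_iff_integrableOn_Ioc_of_le zero_le_one] at this
    have hk : ∀ k ∈ S T, (1 + Real.log (p k) / T)^a =
        ∫ y in Set.Ioc (0:ℝ) 1, Set.indicator (Set.Iic (1 + Real.log (p k) / T)) (fun y => a * y^(a-1)) y := by
      intro k hk
      rw [hS] at hk
      have hpk : 0 < p k := lt_of_lt_of_le (Real.exp_pos _) hk
      have hw0 : 0 ≤ 1 + Real.log (p k) / T := by
        have : -T ≤ Real.log (p k) := by rwa [Real.le_log_iff_exp_le hpk]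
        have : -1 ≤ Real.log (p k) / T := by rw [le_div_iff₀ hT]; linarith
        linarith
      have hw1 : 1 + Real.log (p k) / T ≤ 1 := by
        have := Real.log_nonpos hpk.le (hp k)
        have := div_nonpos_of_nonpos_of_nonneg this hT.le
        linarith
      set w := 1 + Real.log (p k) / T
      rw [MeasureTheory.integral_indicator measurableSet_Iic,
        MeasureTheory.Measure.restrict_restrict measurableSet_Iic]
      have : Set.Iic w ∩ Set.Ioc 0 1 = Set.Ioc 0 w := by
        ext y
        simp only [Set.mem_inter_iff, Set.mem_Iic, Set.mem_Ioc]
        constructor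
        · rintro ⟨h1, h2, h3⟩; exact ⟨h2, h1⟩
        · rintro ⟨h1, h2⟩; exact ⟨h2, h1, by linarith⟩
      rw [this, MeasureTheory.integral_const_mul, ← intervalIntegral.integral_of_le hw0,
        integral_rpow (by left; linarith), sub_add_cancel, Real.zero_rpow ha.ne', sub_zero, mul_div_cancel₀ _ ha.ne']
    rw [Finset.sum_congr rfl hk, ← MeasureTheory.integral_finsetSum]
    · apply MeasureTheory.setIntegral_congr_fun measurableSet_Ioc
      intro y hy
      simp only [Set.indicator_apply, Set.mem_Iic]
      rw [← Finset.sum_filter, Finset.sum_const, nsmul_eq_mul, mul_comm]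
      congr 1
      rw [hRS]
      congr 2
      ext k
      rw [Finset.mem_filter, hS, hS]
      constructor
      · rintro ⟨h1, h2⟩
        have hpk : 0 < p k := lt_of_lt_of_le (Real.exp_pos _) h1
        rw [← Real.le_log_iff_exp_le hpk]
        have : y - 1 ≤ Real.log (p k) / T := by linarith
        rw [le_div_iff₀ hT] at this
        linarith
      · intro h1
        have hpk : 0 < p k := lt_of_lt_of_le (Real.exp_pos _) h1
        constructor
        · refine le_trans ?_ h1
          rw [Real.exp_le_exp]
          nlinarith [hy.1]
        · rw [← Real.le_log_iff_exp_le hpk] at h1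
          have : y - 1 ≤ Real.log (p k) / T := by rw [le_div_iff₀ hT]; linarith
          linarith
    · intro k hk
      exact MeasureTheory.Integrable.indicator hii measurableSet_Iic
  rw [← aux_beta_int a b ha hb]
  have hd : Tendsto (fun T => ∫ y in Set.Ioc (0:ℝ) 1, a * y^(a-1) * (R (T * (1-y)) / R T)) atTop
      (𝓝 (∫ y in Set.Ioc (0:ℝ) 1, a * y^(a-1) * (1-y)^b)) := by
    have hii : MeasureTheory.IntegrableOn (fun y : ℝ => a * y^(a-1)) (Set.Ioc 0 1) := by
      have := (intervalIntegral.intervalIntegrable_rpow' (a := 0) (b := 1) (r := a-1) (by linarith)).const_mul a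
      rwa [intervalIntegrable_iff_integrableOn_Ioc_of_le zero_le_one] at this
    refine MeasureTheory.tendsto_integral_filter_of_dominated_convergence (fun y => a * y^(a-1)) ?_ ?_ hii ?_
    · have : Measurable R := hRmono.measurable
      exact Eventually.of_forall fun T => (Measurable.aestronglyMeasurable (by fun_prop))
    · filter_upwards [hRtop.eventually_gt_atTop 0, eventually_gt_atTop 0] with T hT hT0
      rw [MeasureTheory.ae_restrict_iff' measurableSet_Ioc]
      refine Eventually.of_forall fun y hy => ?_
      have hy0 := hy.1
      have h1 : 0 ≤ R (T * (1-y)) := by rw [hRS]; positivity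
      have h2 : R (T*(1-y)) / R T ≤ 1 := by
        rw [div_le_one hT]
        exact hRmono (by nlinarith)
      rw [Real.norm_of_nonneg (by positivity)]
      exact mul_le_of_le_one_right (by positivity) h2
    · have h1 : ∀ᵐ y : ℝ, y ≠ 1 := by simp [MeasureTheory.ae_iff]
      rw [MeasureTheory.ae_restrict_iff' measurableSet_Ioc]
      filter_upwards [h1] with y hy1 hy
      have : 0 < 1 - y := by
        have := lt_of_le_of_ne hy.2 hy1
        linarith
      have := (hR (1-y) this).const_mul (a * y^(a-1))
      simpa only [mul_comm (1-y)] using this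
  refine hd.congr' ?_
  filter_upwards [eventually_gt_atTop 0] with T hT
  rw [hrep T hT, ← MeasureTheory.integral_div]
  congr 1
  funext y
  ring

lemma aux_unif (R A : ℝ → ℝ) (hRmono : Monotone R) (hRtop : Tendsto R atTop atTop) (b : ℝ)
    (hR : ∀ c > 0, Tendsto (fun T => R (c*T) / R T) atTop (𝓝 (c^b))) (j : ℕ) (C : ℝ)
    (hA : Tendsto (fun T => A T * T / R T^j) atTop (𝓝 C)) (ε : ℝ) (hε : 0 < ε) :
    TendstoUniformlyOn (fun T x => A (T*x) / (R T^j / T)) (fun x => C * x^(j*b-1)) atTop (Set.Icc ε 1) := by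
  rw [← tendstoLocallyUniformlyOn_iff_tendstoUniformlyOn_of_compact isCompact_Icc,
    tendstoLocallyUniformlyOn_iff_forall_tendsto]
  intro x hx
  have hx0 : 0 < x := lt_of_lt_of_le hε hx.1
  have hT : Tendsto (fun y : ℝ × ℝ => y.1) (atTop ×ˢ 𝓝[Set.Icc ε 1] x) atTop := tendsto_fst
  have hX : Tendsto (fun y : ℝ × ℝ => y.2) (atTop ×ˢ 𝓝[Set.Icc ε 1] x) (𝓝 x) :=
    tendsto_snd.mono_right nhdsWithin_le_nhds
  have hTX : Tendsto (fun y : ℝ × ℝ => y.1 * y.2) (atTop ×ˢ 𝓝[Set.Icc ε 1] x) atTop := hT.atTop_mul_pos hx0 hX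
  have hcont : ∀ c > 0, ContinuousAt (fun z : ℝ => z^b) c := fun c hc =>
    Real.continuousAt_rpow_const _ _ (Or.inl hc.ne')
  have hRR : Tendsto (fun y : ℝ × ℝ => R (y.1 * y.2) / R y.1) (atTop ×ˢ 𝓝[Set.Icc ε 1] x) (𝓝 (x^b)) := by
    rw [tendsto_order]
    constructor
    · intro v hv
      have h1 := ((hcont x hx0).tendsto.mono_left (nhdsWithin_le_nhds (s := Set.Iio x))).eventually_const_lt hv
      have h2 : ∀ᶠ z in 𝓝[<] x, 0 < z := (eventually_gt_nhds hx0).filter_mono nhdsWithin_le_nhds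
      obtain ⟨c, ⟨hc1, hc2⟩, hc3⟩ := ((h1.and h2).and self_mem_nhdsWithin).exists
      have hc3 : c < x := hc3
      filter_upwards [hT.eventually ((hR c hc2).eventually_const_lt hc1), hX.eventually_const_lt hc3,
        hT.eventually_gt_atTop 0, hT.eventually (hRtop.eventually_gt_atTop 0)] with y k1 k2 k3 k4
      refine lt_of_lt_of_le k1 ?_
      gcongr
      exact hRmono (by nlinarith)
    · intro v hv
      have h1 := ((hcont x hx0).tendsto.mono_left (nhdsWithin_le_nhds (s := Set.Ioi x))).eventually_lt_const hv
      obtain ⟨c, hc1, hc3⟩ := (h1.and self_mem_nhdsWithin).exists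
      have hc3 : x < c := hc3
      filter_upwards [hT.eventually ((hR c (hx0.trans hc3)).eventually_lt_const hc1), hX.eventually_lt_const hc3,
        hT.eventually_gt_atTop 0, hT.eventually (hRtop.eventually_gt_atTop 0)] with y k1 k2 k3 k4
      refine lt_of_le_of_lt ?_ k1
      gcongr
      exact hRmono (by nlinarith)
  have hmain : Tendsto (fun y : ℝ × ℝ => A (y.1*y.2) / (R y.1^j / y.1)) (atTop ×ˢ 𝓝[Set.Icc ε 1] x) (𝓝 (C * x^(j*b-1))) := by
    have h1 := ((hA.comp hTX).mul (hRR.pow j)).div hX hx0.ne'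
    have e : C * (x^b)^j / x = C * x^(j*b-1) := by
      rw [Real.rpow_sub hx0, Real.rpow_one, mul_comm (j:ℝ) b, Real.rpow_mul hx0.le, Real.rpow_natCast]
      ring
    rw [e] at h1
    refine h1.congr' ?_
    filter_upwards [hX.eventually_const_lt hx0, hT.eventually_gt_atTop 0, hT.eventually (hRtop.eventually_gt_atTop 0), 
      hTX.eventually (hRtop.eventually_gt_atTop 0)] with y k1 k2 k3 k4
    simp only [Function.comp, Pi.div_apply]
    rw [div_pow]
    field_simp
  have hmain2 : Tendsto (fun y : ℝ × ℝ => C * y.2^(j*b-1)) (atTop ×ˢ 𝓝[Set.Icc ε 1] x) (𝓝 (C * x^(j*b-1))) := by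
    exact ((Real.continuousAt_rpow_const x (j*b-1) (Or.inl hx0.ne')).tendsto.comp hX).const_mul C
  have := hmain2.prodMk_nhds hmain
  exact this.mono_right (nhds_le_uniformity _)

lemma aux_dom_pos (R : ℝ → ℝ) (hRmono : Monotone R) (hRtop : Tendsto R atTop atTop) (b : ℝ) (hb : 1 < b)
    (hR : ∀ c > 0, Tendsto (fun T => R (c*T) / R T) atTop (𝓝 (c^b))) :
    ∃ C0 > 0, ∃ u0 > 0, ∀ u ≥ u0, ∀ T ≥ u, R u / u ≤ C0 * (R T / T) := by
  have h2 : (2:ℝ) < 2^b := by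
    have := Real.rpow_lt_rpow_of_exponent_lt (show (1:ℝ) < 2 by norm_num) hb
    simpa using this
  have h3 := (hR 2 (by norm_num)).eventually_const_lt h2
  obtain ⟨v, hv⟩ := eventually_atTop.1 (h3.and (hRtop.eventually_gt_atTop 0))
  refine ⟨2, by norm_num, max v 1, by positivity, ?_⟩
  intro u hu T hT
  have hu1 : 1 ≤ u := le_trans (le_max_right _ _) hu
  have huv : v ≤ u := le_trans (le_max_left _ _) hu
  have hu0 : 0 < u := by linarith
  have hT0 : 0 < T := by linarith
  have hiter : ∀ n : ℕ, 2^n * R u ≤ R (2^n * u) := by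
    intro n
    induction n with
    | zero => simp
    | succ n ih =>
      have h1 : v ≤ 2^n * u := by
        have : (1:ℝ) ≤ 2^n := one_le_pow₀ (by norm_num)
        nlinarith
      obtain ⟨h4, h5⟩ := hv _ h1
      rw [lt_div_iff₀ h5] at h4
      calc 2^(n+1) * R u = 2 * (2^n * R u) := by ring
        _ ≤ 2 * R (2^n*u) := by linarith
        _ ≤ R (2 * (2^n*u)) := h4.le
        _ = _ := by congr 1; ring
  obtain ⟨n, hn1, hn2⟩ := exists_nat_pow_near (show 1 ≤ T/u by rw [le_div_iff₀ hu0]; linarith) (show (1:ℝ) < 2 by norm_num)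
  rw [le_div_iff₀ hu0] at hn1
  rw [div_lt_iff₀ hu0] at hn2
  have h6 := (hiter n).trans (hRmono hn1)
  have hRu := (hv u huv).2
  rw [div_le_iff₀ hu0, mul_div_assoc', div_mul_eq_mul_div, le_div_iff₀ hT0]
  have h7 : R u * T ≤ R u * (2^(n+1) * u) := by gcongr
  calc R u * T ≤ R u * (2^(n+1) * u) := h7
    _ = 2 * (2^n * R u) * u := by ring
    _ ≤ 2 * R T * u := by gcongr

lemma aux_dom_zero (R L : ℝ → ℝ) (hRtop : Tendsto R atTop atTop)
    (hLm : ∃ x₀, MonotoneOn L (Set.Ici x₀))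
    (hK : Tendsto (fun T => T * L T / R T) atTop (𝓝 1)) :
    ∃ C0 > 0, ∃ u0 > 0, ∀ u ≥ u0, ∀ T ≥ u, R u / u ≤ C0 * (R T / T) := by
  obtain ⟨x0, hx0⟩ := hLm
  have h1 := hK.eventually_const_lt (show (1/2:ℝ) < 1 by norm_num)
  have h2 := hK.eventually_lt_const (show (1:ℝ) < 2 by norm_num)
  obtain ⟨v, hv⟩ := eventually_atTop.1 ((h1.and h2).and (hRtop.eventually_gt_atTop 0))
  refine ⟨4, by norm_num, max (max v x0) 1, by positivity, ?_⟩
  intro u hu T hT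
  have hu1 : 1 ≤ u := le_trans (le_max_right _ _) hu
  have huv : v ≤ u := le_trans ((le_max_left _ _).trans (le_max_left _ _)) hu
  have hux : x0 ≤ u := le_trans ((le_max_right _ _).trans (le_max_left _ _)) hu
  have hu0 : 0 < u := by linarith
  have hT0 : 0 < T := by linarith
  obtain ⟨⟨a1, a2⟩, a3⟩ := hv u huv
  obtain ⟨⟨b1, b2⟩, b3⟩ := hv T (by linarith)
  rw [lt_div_iff₀ a3] at a1
  rw [div_lt_iff₀ b3] at b2
  have hLL : L u ≤ L T := hx0 hux (Set.mem_Ici.2 (by linarith)) hT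
  calc R u / u ≤ 2 * L u := by rw [div_le_iff₀ hu0]; nlinarith
    _ ≤ 2 * L T := by linarith
    _ ≤ 4 * (R T / T) := by
      rw [mul_div_assoc', le_div_iff₀ hT0]; nlinarith

lemma aux_dom (R A : ℝ → ℝ) (hRmono : Monotone R) (hRtop : Tendsto R atTop atTop) (hR0 : ∀ T, 0 ≤ R T)
    (hd : ∃ C0 > 0, ∃ u0 > 0, ∀ u ≥ u0, ∀ T ≥ u, R u / u ≤ C0 * (R T / T))
    (j : ℕ) (hj : 1 ≤ j) (C : ℝ)
    (hA : Tendsto (fun T => A T * T / R T^j) atTop (𝓝 C)) (hAe : ∀ u, A u ≤ Real.exp u) :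
    ∃ M ≥ 0, ∀ᶠ T in atTop, ∀ u ≤ T, A u ≤ M * (R T^j / T) := by
  obtain ⟨C0, hC0, u0, hu0, hd⟩ := hd
  have hC1 : C < |C| + 1 := by linarith [le_abs_self C]
  obtain ⟨v, hv⟩ := eventually_atTop.1 ((hA.eventually_lt_const hC1).and (hRtop.eventually_gt_atTop 0))
  set u1 := max v u0
  have hu1 : 0 < u1 := lt_of_lt_of_le hu0 (le_max_right _ _)
  have hV : ∀ u ≥ u1, ∀ T ≥ u, R u^j / u ≤ C0 * (R T^j / T) := by
    intro u hu T hT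
    obtain ⟨i, rfl⟩ : ∃ i, j = i+1 := ⟨j-1, by omega⟩
    have h1 := hd u ((le_max_right _ _).trans hu) T hT
    have h2 : R u^i ≤ R T^i := pow_le_pow_left₀ (hR0 u) (hRmono hT) i
    calc R u^(i+1) / u = R u^i * (R u / u) := by ring
      _ ≤ R T^i * (C0 * (R T / T)) := by
        apply mul_le_mul h2 h1 _ (pow_nonneg (hR0 T) _)
        exact div_nonneg (hR0 u) (by linarith)
      _ = _ := by ring
  have hR1 : 0 < R u1 := (hv u1 (le_max_left _ _)).2
  have hV1 : 0 < R u1^j / u1 := by positivity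
  refine ⟨(|C|+1) * C0 + Real.exp u1 * C0 / (R u1^j / u1), by positivity, ?_⟩
  filter_upwards [eventually_ge_atTop u1] with T hT u hu
  have hVT : 0 ≤ R T^j / T := div_nonneg (pow_nonneg (hR0 T) _) (by linarith)
  rw [add_mul]
  rcases le_total u1 u with h | h
  · obtain ⟨h1, h2⟩ := hv u ((le_max_left _ _).trans h)
    have hupos : 0 < u := by linarith
    have h3 := hV u h T hu
    have h4 : A u ≤ (|C|+1) * (R u^j / u) := by
      rw [div_lt_iff₀ (by positivity)] at h1
      rw [mul_div_assoc', le_div_iff₀ hupos]; exact h1.le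
    have h5 : 0 ≤ Real.exp u1 * C0 / (R u1^j / u1) * (R T^j / T) := by positivity
    have h6 : (|C|+1) * (R u^j / u) ≤ (|C|+1) * (C0 * (R T^j / T)) := by gcongr
    linarith
  · have h1 : A u ≤ Real.exp u1 := (hAe u).trans (Real.exp_le_exp.2 h)
    have h2 := hV u1 le_rfl T hT
    have h5 : 0 ≤ (|C|+1) * C0 * (R T^j / T) := by positivity
    have h6 : Real.exp u1 ≤ Real.exp u1 * C0 / (R u1^j / u1) * (R T^j / T) := by
      rw [div_mul_eq_mul_div, le_div_iff₀ hV1, mul_assoc]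
      gcongr
    linarith

lemma aux_conv (p : ℕ → ℝ) (R : ℝ → ℝ) (S : ℝ → Finset ℕ) (hp : ∀ k, p k ≤ 1)
    (hS : ∀ T k, k ∈ S T ↔ Real.exp (-T) ≤ p k) (hRS : ∀ T, R T = (S T).card)
    (hRmono : Monotone R) (hRtop : Tendsto R atTop atTop) (b : ℝ) (hb : 0 < b)
    (hR : ∀ c > 0, Tendsto (fun T => R (c*T) / R T) atTop (𝓝 (c^b)))
    (A : ℝ → ℝ) (hA0 : ∀ u, 0 ≤ A u) (j : ℕ) (hj : 0 ≤ j*b-1) (C : ℝ) (hC : 0 ≤ C)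
    (hA : Tendsto (fun T => A T * T / R T^j) atTop (𝓝 C))
    (M : ℝ) (hM : 0 ≤ M) (hdom : ∀ᶠ T in atTop, ∀ u ≤ T, A u ≤ M * (R T^j / T)) :
    Tendsto (fun T => (∑ k ∈ S T, A (T + Real.log (p k))) / (R T^j / T) / R T) atTop
      (𝓝 (C * (Real.Gamma (j*b-1+1) * Real.Gamma (b+1) / Real.Gamma (j*b-1+b+1)))) := by
  have hmain := (aux_beta_sum p R S hp hS hRS hRmono hRtop b hb hR (j*b-1) hj).const_mul C
  suffices hdiff : Tendsto (fun T => (∑ k ∈ S T, A (T + Real.log (p k))) / (R T^j / T) / R T -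
      C * ((∑ k ∈ S T, (1 + Real.log (p k) / T)^(j*b-1)) / R T)) atTop (𝓝 0) by
    have := hdiff.add hmain
    simpa using this
  rw [Metric.tendsto_nhds]
  intro η hη
  obtain ⟨ε, hε0, hε1, hε⟩ : ∃ ε > 0, ε < 1 ∧ (M+C) * (1 - (1-ε)^b) < η/2 := by
    have h1 : Tendsto (fun ε : ℝ => (M+C) * (1 - (1-ε)^b)) (𝓝[>] 0) (𝓝 ((M+C) * (1 - (1-0)^b))) := by
      apply Tendsto.mono_left _ nhdsWithin_le_nhds
      have : ContinuousAt (fun ε : ℝ => (M+C) * (1 - (1-ε)^b)) 0 := by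
        have h2 : ContinuousAt (fun ε : ℝ => (1-ε)^b) 0 :=
          ContinuousAt.rpow_const (by fun_prop) (Or.inl (by norm_num))
        fun_prop
      exact this
    have h2 : (M+C) * (1 - (1-0)^b) < η/2 := by simp [hη]
    have h3 := h1.eventually_lt_const h2
    have h4 : ∀ᶠ ε : ℝ in 𝓝[>] 0, ε < 1 := nhdsWithin_le_nhds (eventually_lt_nhds (by norm_num))
    obtain ⟨ε, ⟨h5, h6⟩, h7⟩ := ((h3.and h4).and self_mem_nhdsWithin).exists
    exact ⟨ε, h7, h6, h5⟩
  have h1 : Tendsto (fun T => (M+C) * (1 - R ((1-ε)*T) / R T)) atTop (𝓝 ((M+C) * (1 - (1-ε)^b))) :=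
    ((hR (1-ε) (by linarith)).const_sub 1).const_mul (M+C)
  have h2 := h1.eventually_lt_const hε
  have h3 := Metric.tendstoUniformlyOn_iff.1 (aux_unif R A hRmono hRtop b hR j C hA ε hε0) (η/2) (by linarith)
  filter_upwards [h2, h3, hdom, hRtop.eventually_gt_atTop 0, eventually_gt_atTop 0] with T h2 h3 h4 hRT hT
  have hV : 0 < R T^j / T := by positivity
  have hsub : S ((1-ε)*T) ⊆ S T := by
    intro k hk
    rw [hS] at hk ⊢
    refine le_trans (Real.exp_le_exp.2 ?_) hk
    nlinarith
  have key : ∀ k ∈ S T, |A (T + Real.log (p k)) / (R T^j / T) - C * (1 + Real.log (p k) / T)^(j*b-1)|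
      ≤ η/2 + (if k ∈ S ((1-ε)*T) then 0 else M + C) := by
    intro k hk
    have hk1 := (hS T k).1 hk
    have hpk : 0 < p k := lt_of_lt_of_le (Real.exp_pos _) hk1
    have hl0 : Real.log (p k) ≤ 0 := Real.log_nonpos hpk.le (hp k)
    have hl1 : -T ≤ Real.log (p k) := (Real.le_log_iff_exp_le hpk).2 hk1
    have hw : T + Real.log (p k) = T * (1 + Real.log (p k) / T) := by field_simp
    have hw1 : 1 + Real.log (p k) / T ≤ 1 := by
      have := div_nonpos_of_nonpos_of_nonneg hl0 hT.le; linarith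
    have hw0 : 0 ≤ 1 + Real.log (p k) / T := by
      have : -1 ≤ Real.log (p k) / T := by rw [le_div_iff₀ hT]; linarith
      linarith
    split_ifs with hkε
    · rw [hS] at hkε
      have hl2 : -((1-ε)*T) ≤ Real.log (p k) := (Real.le_log_iff_exp_le hpk).2 hkε
      have hwε : ε ≤ 1 + Real.log (p k) / T := by
        have : -(1-ε) ≤ Real.log (p k) / T := by rw [le_div_iff₀ hT]; linarith
        linarith
      have := h3 _ ⟨hwε, hw1⟩
      rw [Real.dist_eq, abs_sub_comm] at this
      rw [hw]; linarith
    · have e1 : A (T + Real.log (p k)) / (R T^j / T) ≤ M := by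
        rw [div_le_iff₀ hV]; exact h4 _ (by linarith)
      have e2 : 0 ≤ A (T + Real.log (p k)) / (R T^j / T) := div_nonneg (hA0 _) hV.le
      have e3 : (1 + Real.log (p k) / T)^(j*b-1) ≤ 1 := Real.rpow_le_one hw0 hw1 hj
      have e4 : 0 ≤ (1 + Real.log (p k) / T)^(j*b-1) := Real.rpow_nonneg hw0 _
      have e5 : C * (1 + Real.log (p k) / T)^(j*b-1) ≤ C := by nlinarith
      have e6 : 0 ≤ C * (1 + Real.log (p k) / T)^(j*b-1) := mul_nonneg hC e4
      rw [abs_le]; constructor <;> linarith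
  have hsum : ∑ k ∈ S T, (η/2 + (if k ∈ S ((1-ε)*T) then 0 else M + C)) =
      η/2 * R T + (M+C) * (R T - R ((1-ε)*T)) := by
    rw [Finset.sum_add_distrib, Finset.sum_const, nsmul_eq_mul, ← hRS]
    have : ∀ k, (if k ∈ S ((1-ε)*T) then 0 else M + C) = (M + C) - (if k ∈ S ((1-ε)*T) then M+C else 0) := by
      intro k; split_ifs <;> simp
    simp_rw [this]
    rw [Finset.sum_sub_distrib, Finset.sum_const, nsmul_eq_mul, ← hRS, Finset.sum_ite_mem,
      Finset.inter_eq_right.2 hsub, Finset.sum_const, nsmul_eq_mul, ← hRS]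
    ring
  have hbound := (Finset.abs_sum_le_sum_abs _ _).trans (Finset.sum_le_sum key)
  rw [hsum] at hbound
  have heq : (∑ k ∈ S T, A (T + Real.log (p k))) / (R T^j / T) / R T -
      C * ((∑ k ∈ S T, (1 + Real.log (p k) / T)^(j*b-1)) / R T) =
      (∑ k ∈ S T, (A (T + Real.log (p k)) / (R T^j / T) - C * (1 + Real.log (p k) / T)^(j*b-1))) / R T := by
    rw [Finset.sum_sub_distrib, ← Finset.sum_div, ← Finset.mul_sum]
    ring
  rw [Real.dist_eq, sub_zero, heq, abs_div, abs_of_pos hRT, div_lt_iff₀ hRT]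
  refine lt_of_le_of_lt hbound ?_
  have : (M+C) * (R T - R ((1-ε)*T)) < η/2 * R T := by
    have e : (M+C) * (R T - R ((1-ε)*T)) = (M+C) * (1 - R ((1-ε)*T) / R T) * R T := by field_simp
    rw [e]
    exact mul_lt_mul_of_pos_right h2 hRT
  linarith

lemma aux_step (p : ℕ → ℝ) (hp0 : ∀ k, 0 ≤ p k) (hs1 : HasSum p 1) (S : Finset ℕ) (T : ℝ)
    (hS : ∀ k, k ∈ S ↔ Real.exp (-T) ≤ p k) (j : ℕ) :
    0 ≤ fJ p (j+1) (Real.exp T) - ∑ k ∈ S, fJ p j (Real.exp (T + Real.log (p k))) ∧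
    fJ p (j+1) (Real.exp T) - ∑ k ∈ S, fJ p j (Real.exp (T + Real.log (p k))) ≤
      9 * fJ p 1 (Real.exp T) := by
  have hT := Real.exp_pos T
  have htp : ∀ k, 0 ≤ Real.exp T * p k := fun k => mul_nonneg hT.le (hp0 k)
  have hsum : Summable fun k => fJ p j (Real.exp T * p k) :=
    Summable.of_nonneg_of_le (fun k => aux_fJ_nonneg p hp0 j _ (htp k))
      (fun k => aux_fJ_le p hp0 hs1 j _ (htp k)) (hs1.summable.mul_left _)
  have hsumK : Summable fun k => kapK (Real.exp T * p k) :=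
    Summable.of_nonneg_of_le (fun k => kapK_nonneg (htp k))
      (fun k => kapK_le (htp k)) (hs1.summable.mul_left _)
  have hQ : ∑ k ∈ S, fJ p j (Real.exp (T + Real.log (p k))) = ∑ k ∈ S, fJ p j (Real.exp T * p k) := by
    refine Finset.sum_congr rfl fun k hk => ?_
    have hpk : 0 < p k := lt_of_lt_of_le (Real.exp_pos _) ((hS k).1 hk)
    rw [Real.exp_add, Real.exp_log hpk]
  have hS1 : HasSum (fun k => if k ∈ S then fJ p j (Real.exp T * p k) else 0)
      (∑ k ∈ S, fJ p j (Real.exp T * p k)) := by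
    have h1 : ∑ k ∈ S, fJ p j (Real.exp T * p k) =
        ∑ k ∈ S, (if k ∈ S then fJ p j (Real.exp T * p k) else 0) :=
      Finset.sum_congr rfl fun k hk => (if_pos hk).symm
    rw [h1]
    exact hasSum_sum_of_ne_finset_zero fun k hk => if_neg hk
  rw [hQ, aux_fJ_succ p hp0 hs1 j _ hT.le, aux_fJ_one]
  have hd := hsum.hasSum.sub hS1
  constructor
  · refine hd.nonneg fun k => ?_
    split_ifs
    · simp
    · rw [sub_zero]; exact aux_fJ_nonneg p hp0 j _ (htp k)
  · refine hasSum_le (fun k => ?_) hd (hsumK.hasSum.mul_left 9)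
    split_ifs with h
    · rw [sub_self]; exact mul_nonneg (by norm_num) (kapK_nonneg (htp k))
    · rw [sub_zero]
      have h1 : Real.exp T * p k ≤ 1 := by
        rw [hS, not_le] at h
        have := mul_lt_mul_of_pos_left h hT
        rw [← Real.exp_add, add_neg_cancel, Real.exp_zero] at this
        exact this.le
      exact (aux_fJ_le p hp0 hs1 j _ (htp k)).trans (le_kapK (htp k) h1)

theorem stmt4
    (p : ℕ → ℝ) (hp0 : ∀ k, 0 ≤ p k) (hp1 : ∑' k, p k = 1)
    (hpinf : {k | 0 < p k}.Infinite)
    (β : ℝ) (hβ : 0 ≤ β)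
    (ℓ : ℝ → ℝ) (hℓpos : ∀ x > 0, 0 < ℓ x)
    (hℓsv : ∀ c > 0, Tendsto (fun x => ℓ (c * x) / ℓ x) atTop (𝓝 1))
    (h6 : ∀ lam > 0, Tendsto
      (fun t => (rhoJ p 1 (lam * t) - rhoJ p 1 t) / (Real.log t ^ β * ℓ (Real.log t)))
      atTop (𝓝 (Real.log lam)))
    (h60 : β = 0 → (∃ x₀, MonotoneOn ℓ (Set.Ici x₀)) ∧ Tendsto ℓ atTop atTop)
    (j : ℕ) (hj : 1 ≤ j) :
    Tendsto
      (fun T => (PhiJ p j (2 * Real.exp T) - PhiJ p j (Real.exp T)) /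
        (Real.log 2 * (Real.Gamma (β + 1)) ^ j / Real.Gamma (j * (β + 1)) *
          (T ^ ((j : ℝ) * β + j - 1) * (ℓ T) ^ j)))
      atTop (𝓝 1) := by
  have hs : Summable p := aux_summable p hp1
  have hs1 : HasSum p 1 := hp1 ▸ hs.hasSum
  have hple : ∀ k, p k ≤ 1 := fun k => le_hasSum hs1 k fun i _ => hp0 i
  set R : ℝ → ℝ := fun T => rhoJ p 1 (Real.exp T) with hRdef
  set L : ℝ → ℝ := fun T => T^β * ℓ T with hLdef
  have hRmono : Monotone R := fun x y hxy =>
    aux_rho_mono p hs (Set.mem_Ioi.2 (Real.exp_pos x)) (Set.mem_Ioi.2 (Real.exp_pos y)) (Real.exp_le_exp.2 hxy)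
  have hRtop : Tendsto R atTop atTop := (aux_rho_top p hs hpinf).comp Real.tendsto_exp_atTop
  have hR0 : ∀ T, 0 ≤ R T := fun T => aux_rho_nonneg p 1 _
  have hLpos' : ∀ T > 0, 0 < L T := fun T hT => mul_pos (Real.rpow_pos_of_pos hT _) (hℓpos T hT)
  have hLpos : ∀ᶠ T in atTop, 0 < L T := by
    filter_upwards [eventually_gt_atTop 0] with T hT using hLpos' T hT
  have hL : ∀ h > 0, Tendsto (fun T => (R (T+h) - R T) / L T) atTop (𝓝 h) := by
    intro h hh
    have h1 := (h6 (Real.exp h) (Real.exp_pos h)).comp Real.tendsto_exp_atTop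
    rw [Real.log_exp] at h1
    refine h1.congr fun T => ?_
    simp only [Function.comp, Real.log_exp, hRdef, hLdef]
    rw [Real.exp_add, mul_comm (Real.exp h)]
  have hLrv : ∀ c > 0, Tendsto (fun T => L (c*T) / L T) atTop (𝓝 (c^β)) := by
    intro c hc
    have h1 := (hℓsv c hc).const_mul (c^β)
    rw [mul_one] at h1
    refine h1.congr' ?_
    filter_upwards [eventually_gt_atTop 0] with T hT
    simp only [hLdef]
    rw [Real.mul_rpow hc.le hT.le]
    have := (Real.rpow_pos_of_pos hT β).ne'
    have := (hℓpos T hT).ne'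
    field_simp
  have hR := fun c hc => aux_regvar R L β hRmono hRtop hR0 hLpos hL hLrv hβ c hc
  have hK := aux_karamata R L β hRmono hRtop hLpos hL hLrv hβ hR
  have hd : ∃ C0 > 0, ∃ u0 > 0, ∀ u ≥ u0, ∀ T ≥ u, R u / u ≤ C0 * (R T / T) := by
    rcases hβ.eq_or_lt with hβ0 | hβ0
    · refine aux_dom_zero R L hRtop ?_ (by simpa [← hβ0] using hK)
      have : L = ℓ := by funext T; simp [hLdef, ← hβ0]
      rw [this]
      exact (h60 hβ0.symm).1
    · exact aux_dom_pos R hRmono hRtop (β+1) (by linarith) hR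
  have hb : 0 < β + 1 := by linarith
  choose S hS1 hS2 using fun T : ℝ => aux_rho_finset p hs (Real.exp T) (Real.exp_pos T)
  have hS : ∀ T k, k ∈ S T ↔ Real.exp (-T) ≤ p k := by
    intro T k; rw [hS1, one_div, Real.exp_neg]
  have hRS : ∀ T, R T = (S T).card := hS2
  have hlog2 : 0 < Real.log 2 := Real.log_pos (by norm_num)
  have hbase0 : Tendsto (fun T => fJ p 1 (Real.exp T) / L T) atTop (𝓝 (Real.log 2)) := by
    have hg : ∀ᶠ t in atTop, 0 < Real.log t ^ β * ℓ (Real.log t) := by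
      filter_upwards [Real.tendsto_log_atTop.eventually_gt_atTop 0] with t ht using hLpos' _ ht
    have h1 := (aux_dct1 (rhoJ p 1) (fun t => Real.log t ^ β * ℓ (Real.log t)) (aux_rho_mono p hs)
      (fun x => aux_rho_nonneg p 1 x) hg h6).comp Real.tendsto_exp_atTop
    refine h1.congr fun T => ?_
    simp only [Function.comp, Real.log_exp, hLdef]
    rw [aux_fJ_one, aux_f1_integral p hp0 hs _ (Real.exp_pos T)]
  have hbase : Tendsto (fun T => fJ p 1 (Real.exp T) * T / R T) atTop (𝓝 (Real.log 2 * (β+1))) := by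
    refine (hbase0.mul hK).congr' ?_
    filter_upwards [hLpos] with T hT
    have := hT.ne'
    field_simp
  have hind : ∀ n : ℕ, Tendsto (fun T => fJ p (n+1) (Real.exp T) * T / R T^(n+1)) atTop
      (𝓝 (Real.log 2 * Real.Gamma (β+1+1)^(n+1) / Real.Gamma (((n+1 : ℕ):ℝ) * (β+1)))) := by
    intro n
    induction n with
    | zero =>
      have e : Real.log 2 * Real.Gamma (β+1+1)^(0+1) / Real.Gamma (((0+1 : ℕ):ℝ) * (β+1)) =
          Real.log 2 * (β+1) := by
        have := (Real.Gamma_pos_of_pos hb).ne'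
        rw [Real.Gamma_add_one hb.ne']
        simp only [zero_add, pow_one, Nat.cast_one, one_mul]
        field_simp
      rw [e]
      simpa using hbase
    | succ n ih =>
      set C := Real.log 2 * Real.Gamma (β+1+1)^(n+1) / Real.Gamma (((n+1 : ℕ):ℝ) * (β+1)) with hCdef
      have hG1 : 0 < Real.Gamma (β+1+1) := Real.Gamma_pos_of_pos (by linarith)
      have hG2 : 0 < Real.Gamma (((n+1 : ℕ):ℝ) * (β+1)) := Real.Gamma_pos_of_pos (by positivity)
      have hC : 0 ≤ C := by positivity
      obtain ⟨M, hM, hdom⟩ := aux_dom R (fun u => fJ p (n+1) (Real.exp u)) hRmono hRtop hR0 hd (n+1)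
        (by omega) C ih (fun u => aux_fJ_le p hp0 hs1 _ _ (Real.exp_pos u).le)
      have hj0 : 0 ≤ ((n+1 : ℕ):ℝ) * (β+1) - 1 := by
        push_cast
        have : (0:ℝ) ≤ n := Nat.cast_nonneg n
        nlinarith
      have hc := aux_conv p R S hple hS hRS hRmono hRtop (β+1) hb hR (fun u => fJ p (n+1) (Real.exp u))
        (fun u => aux_fJ_nonneg p hp0 _ _ (Real.exp_pos u).le) (n+1) hj0 C hC ih M hM hdom
      have htail : Tendsto (fun T => 9 * (fJ p 1 (Real.exp T) * T / R T) / R T^(n+1)) atTop (𝓝 0) :=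
        (hbase.const_mul 9).div_atTop ((tendsto_pow_atTop (by omega)).comp hRtop)
      have hdiff : Tendsto (fun T => fJ p (n+1+1) (Real.exp T) * T / R T^(n+1+1) -
          (∑ k ∈ S T, fJ p (n+1) (Real.exp (T + Real.log (p k)))) / (R T^(n+1) / T) / R T) atTop (𝓝 0) := by
        refine tendsto_of_tendsto_of_tendsto_of_le_of_le' tendsto_const_nhds htail ?_ ?_
        · filter_upwards [eventually_gt_atTop 0, hRtop.eventually_gt_atTop 0] with T hT hRT
          have h1 := (aux_step p hp0 hs1 (S T) T (hS T) (n+1)).1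
          have e : fJ p (n+1+1) (Real.exp T) * T / R T^(n+1+1) -
            (∑ k ∈ S T, fJ p (n+1) (Real.exp (T + Real.log (p k)))) / (R T^(n+1) / T) / R T =
            (fJ p (n+1+1) (Real.exp T) - ∑ k ∈ S T, fJ p (n+1) (Real.exp (T + Real.log (p k)))) * (T / R T^(n+1+1)) := by
            field_simp
            ring
          rw [e]
          positivity
        · filter_upwards [eventually_gt_atTop 0, hRtop.eventually_gt_atTop 0] with T hT hRT
          have h1 := (aux_step p hp0 hs1 (S T) T (hS T) (n+1)).2
          have e : fJ p (n+1+1) (Real.exp T) * T / R T^(n+1+1) -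
            (∑ k ∈ S T, fJ p (n+1) (Real.exp (T + Real.log (p k)))) / (R T^(n+1) / T) / R T =
            (fJ p (n+1+1) (Real.exp T) - ∑ k ∈ S T, fJ p (n+1) (Real.exp (T + Real.log (p k)))) * (T / R T^(n+1+1)) := by
            field_simp
            ring
          have e2 : 9 * (fJ p 1 (Real.exp T) * T / R T) / R T^(n+1) = 9 * fJ p 1 (Real.exp T) * (T / R T^(n+1+1)) := by
            field_simp
            ring
          rw [e, e2]
          gcongr
      have h2 := hdiff.add hc
      simp only [sub_add_cancel, zero_add] at h2
      have e : C * (Real.Gamma (((n+1 : ℕ):ℝ) * (β+1)) * Real.Gamma (β+1+1) /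
          Real.Gamma (((n+1 : ℕ):ℝ) * (β+1) - 1 + (β+1) + 1)) =
          Real.log 2 * Real.Gamma (β+1+1)^(n+1+1) / Real.Gamma (((n+1+1 : ℕ):ℝ) * (β+1)) := by
        have e3 : ((n+1 : ℕ):ℝ) * (β+1) - 1 + (β+1) + 1 = ((n+1+1 : ℕ):ℝ) * (β+1) := by
          push_cast; ring
        rw [e3, hCdef]
        have := hG2.ne'
        field_simp
        ring
      rw [e] at h2
      exact h2
  obtain ⟨n, rfl⟩ : ∃ n, j = n+1 := ⟨j-1, by omega⟩
  have hGb : 0 < Real.Gamma (β+1) := Real.Gamma_pos_of_pos hb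
  have hGj : 0 < Real.Gamma (((n+1 : ℕ):ℝ) * (β+1)) := Real.Gamma_pos_of_pos (by positivity)
  have hfin := ((hind n).div (hK.pow (n+1)) (by positivity)).div_const
    (Real.log 2 * (Real.Gamma (β + 1)) ^ (n+1) / Real.Gamma (((n+1 : ℕ):ℝ) * (β + 1)))
  have e : Real.log 2 * Real.Gamma (β+1+1)^(n+1) / Real.Gamma (((n+1 : ℕ):ℝ) * (β+1)) / (β+1)^(n+1) /
      (Real.log 2 * (Real.Gamma (β + 1)) ^ (n+1) / Real.Gamma (((n+1 : ℕ):ℝ) * (β + 1))) = 1 := by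
    rw [Real.Gamma_add_one hb.ne', mul_pow]
    have := hGb.ne'
    have := hGj.ne'
    field_simp
  rw [e] at hfin
  refine hfin.congr' ?_
  filter_upwards [eventually_gt_atTop 0, hRtop.eventually_gt_atTop 0] with T hT hRT
  rw [aux_Phi p hp0 hs1 _ _ (Real.exp_pos T).le]
  have hpow : T ^ (((n+1 : ℕ) : ℝ) * β + ((n+1 : ℕ) : ℝ) - 1) * (ℓ T) ^ (n+1) = T^(n+1) * (L T)^(n+1) / T := by
    rw [Real.rpow_sub hT, Real.rpow_add hT, Real.rpow_natCast, Real.rpow_one, mul_comm _ β,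
      Real.rpow_mul hT.le, Real.rpow_natCast]
    simp only [hLdef]
    rw [mul_pow]
    ring
  rw [hpow]
  simp only [Pi.div_apply, div_pow, mul_pow]
  have := (hLpos' T hT).ne'
  have := hGb.ne'
  have := hGj.ne'
  field_simp
end

section
/- Under Condition (6), for every j ∈ ℕ and all u, v ∈ ℝ, lim_{T→∞} (Φ_j(e^{T+u} + e^{T+v}) − Φ_j(max(e^{T+u}, e^{T+v}))) / (T^{jβ+j−1} (ℓ(T))^j) = (Γ(β+1))^j / Γ(j(β+1)) · log(1 + e^{−|u−v|}). -/
open Filter Topology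

namespace Karlin

open MeasureTheory Set

/-- Locally regularly varying measures on the half line. -/
structure LV (μ : Measure ℝ) (g : ℝ → ℝ) (γ : ℝ) : Prop where
  neg : ∀ x < 0, μ (Iic x) = 0
  fin : ∀ x, μ (Iic x) ≠ ⊤
  pos : ∀ T > 0, 0 < g T
  rv : ∀ c > 0, Tendsto (fun T => g (c * T) / g T) atTop (𝓝 (c ^ γ))
  inc : ∀ c d, c ≤ d → Tendsto (fun T => μ.real (Ioc (T + c) (T + d)) / g T) atTop (𝓝 (d - c))
  dom : ∃ C N, 0 < C ∧ ∀ s T, N ≤ s → s ≤ T → g s ≤ C * g T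

lemma LV.fin_Ioc {μ : Measure ℝ} {g : ℝ → ℝ} {γ : ℝ} (h : LV μ g γ) (a b : ℝ) :
    μ (Ioc a b) ≠ ⊤ :=
  ne_top_of_le_ne_top (h.fin b) (measure_mono Ioc_subset_Iic_self)

lemma LV.shift {μ : Measure ℝ} {g : ℝ → ℝ} {γ : ℝ} (h : LV μ g γ) (a : ℝ) :
    Tendsto (fun T => g (T + a) / g T) atTop (𝓝 1) := by
  have h1 := h.inc a (a + 1) (by linarith)
  have h2 := (h.inc 0 1 (by norm_num)).comp (tendsto_atTop_add_const_right atTop a tendsto_id)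
  have h3 := h1.div h2 (by norm_num)
  have e : (a + 1 - a) / ((1:ℝ) - 0) = 1 := by ring
  rw [e] at h3
  refine h3.congr' ?_
  have h4 := h2.eventually (lt_mem_nhds (show (1:ℝ)/2 < 1 - 0 by norm_num))
  filter_upwards [h4, eventually_gt_atTop 0, eventually_gt_atTop (-a)] with T hT hT0 hTa
  have p1 := h.pos T hT0
  have p2 := h.pos (T + a) (by linarith)
  simp only [Function.comp, id, Pi.div_apply, add_zero] at hT ⊢
  rw [← add_assoc]
  have : μ.real (Ioc (T + a) (T + a + 1)) ≠ 0 := by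
    intro h0; rw [h0] at hT; norm_num at hT
  field_simp

lemma LV.bound {μ : Measure ℝ} {g : ℝ → ℝ} {γ : ℝ} (h : LV μ g γ) (c d H : ℝ) (hcd : c ≤ d) :
    ∃ C N, 0 < C ∧ ∀ T, N ≤ T → ∀ s, s ≤ T + H → μ.real (Ioc (s + c) (s + d)) ≤ C * g T := by
  obtain ⟨C, N, hC, hdom⟩ := h.dom
  have h1 := (h.inc c d hcd).eventually (gt_mem_nhds (show d - c < d - c + 1 by linarith))
  obtain ⟨N1, hN1⟩ := eventually_atTop.1 h1
  have h2 := (h.shift H).eventually (gt_mem_nhds (show (1:ℝ) < 2 by norm_num))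
  obtain ⟨N2, hN2⟩ := eventually_atTop.1 h2
  set M := max (max N N1) 1 with hM
  have hMN : N ≤ M := le_trans (le_max_left _ _) (le_max_left _ _)
  have hMN1 : N1 ≤ M := le_trans (le_max_right _ _) (le_max_left _ _)
  have hM1 : 1 ≤ M := le_max_right _ _
  set K := μ.real (Iic (M + d)) with hK
  have hK0 : 0 ≤ K := measureReal_nonneg
  have hgM := h.pos M (by linarith)
  refine ⟨(d - c + 1) * (C * 2) + K * C / g M, max (max N2 M) (M - H), by positivity, ?_⟩
  intro T hT s hs
  have hT2 : N2 ≤ T := le_trans (le_trans (le_max_left _ _) (le_max_left _ _)) hT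
  have hTM : M ≤ T := le_trans (le_trans (le_max_right _ _) (le_max_left _ _)) hT
  have hgT := h.pos T (by linarith)
  rcases le_total M s with hsM | hsM
  · have a1 := hN1 s (hMN1.trans hsM)
    have hgs := h.pos s (by linarith)
    rw [div_lt_iff₀ hgs] at a1
    have a2 := hdom s (T + H) (hMN.trans hsM) hs
    have a3 := hN2 T hT2
    rw [div_lt_iff₀ hgT] at a3
    have a4 : C * g (T + H) ≤ C * (2 * g T) := mul_le_mul_of_nonneg_left a3.le hC.le
    have a5 : (d - c + 1) * g s ≤ (d - c + 1) * (C * (2 * g T)) :=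
      mul_le_mul_of_nonneg_left (a2.trans a4) (by linarith)
    have a6 : 0 ≤ K * C / g M * g T := by positivity
    nlinarith
  · have a1 : μ.real (Ioc (s + c) (s + d)) ≤ K :=
      measureReal_mono (fun x hx => hx.2.trans (by linarith)) (h.fin _)
    have a2 := hdom M T hMN hTM
    have a3 : K ≤ K * C / g M * g T := by
      rw [div_mul_eq_mul_div, le_div_iff₀ hgM]
      nlinarith [mul_le_mul_of_nonneg_left a2 hK0]
    have a4 : 0 ≤ (d - c + 1) * (C * 2) * g T := by
      have : 0 ≤ d - c + 1 := by linarith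
      positivity
    nlinarith

lemma LV.zero_Ioc {μ : Measure ℝ} {g : ℝ → ℝ} {γ : ℝ} (h : LV μ g γ) (a b : ℝ) (hb : b < 0) :
    μ.real (Ioc a b) = 0 := by
  have : μ (Ioc a b) = 0 := measure_mono_null Ioc_subset_Iic_self (h.neg b hb)
  simp [Measure.real, this]

lemma LV.meas {μ : Measure ℝ} [SFinite μ] (c d : ℝ) :
    Measurable (fun s => μ (Ioc (s + c) (s + d))) := by
  have h1 : MeasurableSet {q : ℝ × ℝ | q.1 + c < q.2} :=
    measurableSet_lt (by fun_prop) (by fun_prop)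
  have h2 : MeasurableSet {q : ℝ × ℝ | q.2 ≤ q.1 + d} :=
    measurableSet_le (by fun_prop) (by fun_prop)
  exact measurable_measure_prodMk_left (h1.inter h2)

/-- Scaled limits. -/
lemma LV.lim_scale {μ : Measure ℝ} {g : ℝ → ℝ} {γ : ℝ} (h : LV μ g γ) (c d x : ℝ) (hcd : c ≤ d)
    (hx : 0 < x) :
    Tendsto (fun T => μ.real (Ioc (x * T + c) (x * T + d)) / g T) atTop (𝓝 ((d - c) * x ^ γ)) := by
  have h1 := (h.inc c d hcd).comp (tendsto_id.const_mul_atTop hx)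
  refine (h1.mul (h.rv x hx)).congr' ?_
  filter_upwards [eventually_gt_atTop 0] with T hT
  have := h.pos (x * T) (by positivity)
  simp only [Function.comp, id]
  field_simp

lemma LV.lim_scale_neg {μ : Measure ℝ} {g : ℝ → ℝ} {γ : ℝ} (h : LV μ g γ) (c d x : ℝ)
    (hx : x < 0) :
    Tendsto (fun T => μ.real (Ioc (x * T + c) (x * T + d)) / g T) atTop (𝓝 0) := by
  refine tendsto_const_nhds.congr' ?_
  have := (tendsto_id (α := ℝ) (x := atTop)).const_mul_atTop_of_neg hx
  filter_upwards [this.eventually (eventually_lt_atBot (-d))] with T hT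
  rw [h.zero_Ioc _ _ (by simp only [id] at hT; linarith), zero_div]

/-- the smoothed convolution -/
noncomputable def smI (μ ν : Measure ℝ) (c d δ T : ℝ) : ENNReal :=
  ∫⁻ y, μ (Ioc (T - y + c) (T - y + d)) * ν (Ioc y (y + δ))

lemma smI_eq (μ ν : Measure ℝ) [SFinite μ] [SFinite ν] (c d δ T : ℝ) :
    smI μ ν c d δ T = ∫⁻ q, volume {y : ℝ | q.1 ∈ Ioc (T - y + c) (T - y + d) ∧ q.2 ∈ Ioc y (y + δ)}
      ∂(μ.prod ν) := by
  set S : Set (ℝ × (ℝ × ℝ)) :=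
    {w | w.2.1 ∈ Ioc (T - w.1 + c) (T - w.1 + d) ∧ w.2.2 ∈ Ioc w.1 (w.1 + δ)} with hS
  have hSm : MeasurableSet S := by
    have h1 : MeasurableSet {w : ℝ × (ℝ × ℝ) | T - w.1 + c < w.2.1} :=
      measurableSet_lt (by fun_prop) (by fun_prop)
    have h2 : MeasurableSet {w : ℝ × (ℝ × ℝ) | w.2.1 ≤ T - w.1 + d} :=
      measurableSet_le (by fun_prop) (by fun_prop)
    have h3 : MeasurableSet {w : ℝ × (ℝ × ℝ) | w.1 < w.2.2} :=
      measurableSet_lt (by fun_prop) (by fun_prop)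
    have h4 : MeasurableSet {w : ℝ × (ℝ × ℝ) | w.2.2 ≤ w.1 + δ} :=
      measurableSet_le (by fun_prop) (by fun_prop)
    exact (h1.inter h2).inter (h3.inter h4)
  have e1 := Measure.prod_apply (μ := (volume : Measure ℝ)) (ν := μ.prod ν) hSm
  have e2 := Measure.prod_apply_symm (μ := (volume : Measure ℝ)) (ν := μ.prod ν) hSm
  rw [e1] at e2
  rw [smI]
  refine Eq.trans (lintegral_congr fun y => ?_) e2
  rw [← Measure.prod_prod]
  rfl

lemma conv_eq (μ ν : Measure ℝ) {E : Set ℝ} (hE : MeasurableSet E) :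
    (μ.conv ν) E = (μ.prod ν) {q | q.1 + q.2 ∈ E} := by
  rw [Measure.conv, Measure.map_apply measurable_add hE]
  rfl

lemma smI_ge (μ ν : Measure ℝ) [SFinite μ] [SFinite ν] (c d δ T : ℝ) :
    ENNReal.ofReal δ * (μ.conv ν) (Ioc (T + (c + δ)) (T + d)) ≤ smI μ ν c d δ T := by
  rw [smI_eq, conv_eq _ _ measurableSet_Ioc]
  have hm : MeasurableSet {q : ℝ × ℝ | q.1 + q.2 ∈ Ioc (T + (c + δ)) (T + d)} :=
    measurable_add measurableSet_Ioc
  rw [← lintegral_indicator_const hm]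
  refine lintegral_mono fun q => ?_
  by_cases hq : q ∈ {q : ℝ × ℝ | q.1 + q.2 ∈ Ioc (T + (c + δ)) (T + d)}
  · rw [indicator_of_mem hq]
    have : ENNReal.ofReal δ = volume (Ico (q.2 - δ) q.2) := by
      rw [Real.volume_Ico]; congr 1; ring
    rw [this]
    refine measure_mono fun y hy => ?_
    have h1 := hq.1
    have h2 := hq.2
    have h3 := hy.1
    have h4 := hy.2
    refine ⟨⟨?_, ?_⟩, ?_, ?_⟩ <;> linarith
  · rw [indicator_of_notMem hq]; exact zero_le

lemma smI_le (μ ν : Measure ℝ) [SFinite μ] [SFinite ν] (c d δ T : ℝ) :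
    smI μ ν c d δ T ≤ ENNReal.ofReal δ * (μ.conv ν) (Ioc (T + c) (T + (d + δ))) := by
  rw [smI_eq, conv_eq _ _ measurableSet_Ioc]
  have hm : MeasurableSet {q : ℝ × ℝ | q.1 + q.2 ∈ Ioc (T + c) (T + (d + δ))} :=
    measurable_add measurableSet_Ioc
  rw [← lintegral_indicator_const hm]
  refine lintegral_mono fun q => ?_
  by_cases hq : q ∈ {q : ℝ × ℝ | q.1 + q.2 ∈ Ioc (T + c) (T + (d + δ))}
  · rw [indicator_of_mem hq]
    have : ENNReal.ofReal δ = volume (Ico (q.2 - δ) q.2) := by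
      rw [Real.volume_Ico]; congr 1; ring
    rw [this]
    refine measure_mono fun y hy => ?_
    have h1 := hy.2.1
    have h2 := hy.2.2
    constructor <;> linarith
  · rw [indicator_of_notMem hq]
    have : {y : ℝ | q.1 ∈ Ioc (T - y + c) (T - y + d) ∧ q.2 ∈ Ioc y (y + δ)} = ∅ := by
      ext y
      simp only [mem_ofPred_eq, mem_empty_iff_false, iff_false]
      rintro ⟨⟨h1, h2⟩, h3, h4⟩
      apply hq
      constructor <;> linarith
    rw [this, measure_empty]

lemma smI_real (μ ν : Measure ℝ) [SFinite μ] [SFinite ν]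
    (hμ : ∀ a b, μ (Ioc a b) ≠ ⊤) (hν : ∀ a b, ν (Ioc a b) ≠ ⊤) (c d δ T : ℝ) (hT : 0 < T) :
    (smI μ ν c d δ T).toReal =
      T * ∫ x, μ.real (Ioc ((1 - x) * T + c) ((1 - x) * T + d)) *
        ν.real (Ioc (x * T + 0) (x * T + δ)) := by
  have hm1 : Measurable (fun y => μ (Ioc (T - y + c) (T - y + d))) :=
    (LV.meas c d).comp (by fun_prop)
  have hm2 : Measurable (fun y => ν (Ioc y (y + δ))) := by
    simpa using LV.meas (μ := ν) 0 δ
  have h1 : (smI μ ν c d δ T).toReal = ∫ y, (μ (Ioc (T - y + c) (T - y + d)) * ν (Ioc y (y + δ))).toReal := by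
    rw [smI, integral_toReal (f := fun y => μ (Ioc (T - y + c) (T - y + d)) * ν (Ioc y (y + δ)))
      (hm1.mul hm2).aemeasurable]
    exact ae_of_all _ fun y => ENNReal.mul_lt_top (hμ _ _).lt_top (hν _ _).lt_top
  rw [h1]
  have h2 := Measure.integral_comp_mul_right
    (fun y => (μ (Ioc (T - y + c) (T - y + d)) * ν (Ioc y (y + δ))).toReal) T
  rw [abs_of_pos (inv_pos.2 hT), smul_eq_mul] at h2
  have h3 : ∀ A B : ℝ, A = T⁻¹ * B → B = T * A := by
    intro A B h; rw [h]; field_simp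
  rw [h3 _ _ h2]
  congr 1
  refine integral_congr_ae (ae_of_all _ fun x => ?_)
  simp only [ENNReal.toReal_mul, Measure.real, add_zero]
  congr 5 <;> ring

lemma integral_betaPDFReal {α β : ℝ} (hα : 0 < α) (hβ : 0 < β) :
    ∫ x, ProbabilityTheory.betaPDFReal α β x = 1 := by
  rw [integral_eq_lintegral_of_nonneg_ae]
  · have := ProbabilityTheory.lintegral_betaPDF_eq_one hα hβ
    simp only [ProbabilityTheory.betaPDF] at this
    rw [this]; rfl
  · refine ae_of_all _ fun x => ?_
    simp only [ProbabilityTheory.betaPDFReal, Pi.zero_apply]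
    split_ifs with h
    · have := ProbabilityTheory.beta_pos hα hβ
      have h1 : 0 < x := h.1
      have h2 : 0 < 1 - x := by linarith [h.2]
      positivity
    · exact le_rfl
  · exact (ProbabilityTheory.measurable_betaPDFReal _ _).aestronglyMeasurable

lemma smI_lim {μ ν : Measure ℝ} [SFinite μ] [SFinite ν] {a b : ℝ → ℝ} {α γ : ℝ}
    (hα : 0 < α + 1) (hγ : 0 < γ + 1)
    (h : LV μ a α) (k : LV ν b γ) (c d δ : ℝ) (hcd : c ≤ d) (hδ : 0 ≤ δ) :
    Tendsto (fun T => (smI μ ν c d δ T).toReal / (T * (a T * b T))) atTop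
      (𝓝 ((d - c) * δ * ProbabilityTheory.beta (γ + 1) (α + 1))) := by
  set B := ProbabilityTheory.beta (γ + 1) (α + 1) with hB
  have hBpos : 0 < B := ProbabilityTheory.beta_pos hγ hα
  set f : ℝ → ℝ → ℝ := fun T x => (μ.real (Ioc ((1 - x) * T + c) ((1 - x) * T + d)) / a T) *
    (ν.real (Ioc (x * T + 0) (x * T + δ)) / b T) with hf
  obtain ⟨C1, N1, hC1, hb1⟩ := h.bound c d (max δ 0) hcd
  obtain ⟨C2, N2, hC2, hb2⟩ := k.bound 0 δ (max d 0) hδ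
  have key : Tendsto (fun T => ∫ x, f T x) atTop
      (𝓝 (∫ x, (d - c) * δ * B * ProbabilityTheory.betaPDFReal (γ + 1) (α + 1) x)) := by
    refine tendsto_integral_filter_of_dominated_convergence
      ((Icc (-1) 2).indicator fun _ => C1 * C2) ?_ ?_ ?_ ?_
    · refine Eventually.of_forall fun T => Measurable.aestronglyMeasurable ?_
      have m1 : Measurable (fun x : ℝ => μ.real (Ioc ((1 - x) * T + c) ((1 - x) * T + d))) :=
        ((LV.meas (μ := μ) c d).ennreal_toReal).comp (g := fun s => (μ (Ioc (s + c) (s + d))).toReal)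
          (f := fun x => (1 - x) * T) (by fun_prop)
      have m2 : Measurable (fun x : ℝ => ν.real (Ioc (x * T + 0) (x * T + δ))) :=
        ((LV.meas (μ := ν) 0 δ).ennreal_toReal).comp (g := fun s => (ν (Ioc (s + 0) (s + δ))).toReal)
          (f := fun x => x * T) (by fun_prop)
      exact (m1.div_const _).mul (m2.div_const _)
    · filter_upwards [eventually_ge_atTop N1, eventually_ge_atTop N2, eventually_gt_atTop 0,
        eventually_gt_atTop (max δ 0), eventually_gt_atTop (max d 0)] with T t1 t2 t0 t3 t4
      refine ae_of_all _ fun x => ?_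
      have pa := h.pos T t0
      have pb := k.pos T t0
      have hnn : 0 ≤ f T x := by
        simp only [hf]
        positivity
      rw [Real.norm_of_nonneg hnn]
      have hd1 := le_max_left d 0
      have hd2 := le_max_left δ 0
      by_cases hx1 : x * T + δ < 0
      · simp only [hf]
        rw [k.zero_Ioc _ _ hx1, zero_div, mul_zero]
        exact indicator_nonneg (fun _ _ => by positivity) _
      by_cases hx2 : (1 - x) * T + d < 0
      · simp only [hf]
        rw [h.zero_Ioc _ _ hx2, zero_div, zero_mul]
        exact indicator_nonneg (fun _ _ => by positivity) _
      push Not at hx1 hx2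
      have hxm : x ∈ Icc (-1 : ℝ) 2 := by
        constructor <;> by_contra hh <;> push Not at hh <;> nlinarith
      rw [indicator_of_mem hxm]
      have q1 := hb1 T t1 ((1 - x) * T) (by linarith)
      have q2 := hb2 T t2 (x * T) (by linarith)
      simp only [hf]
      refine mul_le_mul ?_ ?_ (by positivity) hC1.le
      · rwa [div_le_iff₀ pa]
      · rwa [div_le_iff₀ pb]
    · exact (integrable_indicator_iff measurableSet_Icc).2
        (integrableOn_const (by simp))
    · have h0 : ∀ᵐ x : ℝ, x ≠ 0 := by simp [ae_iff]
      have h1 : ∀ᵐ x : ℝ, x ≠ 1 := by simp [ae_iff]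
      filter_upwards [h0, h1] with x x0 x1
      have both : ∀ x : ℝ, 0 < x → x < 1 → Tendsto (fun T => f T x) atTop
          (𝓝 (((d - c) * (1 - x) ^ α) * ((δ - 0) * x ^ γ))) := fun x hx0 hx1 =>
        (h.lim_scale c d (1 - x) hcd (by linarith)).mul (k.lim_scale 0 δ x hδ hx0)
      by_cases hx : 0 < x ∧ x < 1
      · have := both x hx.1 hx.2
        convert this using 2
        rw [ProbabilityTheory.betaPDFReal, if_pos hx, ← hB]
        simp only [add_sub_cancel_right, sub_zero]
        field_simp
      · rw [ProbabilityTheory.betaPDFReal, if_neg hx, mul_zero]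
        rcases lt_or_gt_of_ne x0 with hx0 | hx0
        · have := (h.lim_scale c d (1 - x) hcd (by linarith)).mul (k.lim_scale_neg 0 δ x hx0)
          rwa [mul_zero] at this
        · have hx1 : 1 < x := lt_of_le_of_ne (by
            by_contra hh; exact hx ⟨hx0, by linarith⟩) (Ne.symm x1)
          have := (h.lim_scale_neg c d (1 - x) (by linarith)).mul (k.lim_scale 0 δ x hδ hx0)
          rwa [zero_mul] at this
  rw [integral_const_mul, integral_betaPDFReal hγ hα, mul_one] at key
  refine key.congr' ?_
  filter_upwards [eventually_gt_atTop 0] with T hT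
  have pa := h.pos T hT
  have pb := k.pos T hT
  rw [smI_real μ ν h.fin_Ioc k.fin_Ioc c d δ T hT, mul_div_mul_left _ _ hT.ne', ← integral_div]
  refine integral_congr_ae (ae_of_all _ fun x => ?_)
  simp only [hf]
  rw [div_mul_div_comm]

lemma conv_Iic_le {μ ν : Measure ℝ} [SFinite μ] [SFinite ν]
    (hμ : ∀ x < 0, μ (Iic x) = 0) (hν : ∀ x < 0, ν (Iic x) = 0) (x : ℝ) :
    (μ.conv ν) (Iic x) ≤ μ (Iic x) * ν (Iic x) := by
  have z : ∀ ρ : Measure ℝ, (∀ x < 0, ρ (Iic x) = 0) → ρ (Iio 0) = 0 := by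
    intro ρ hρ
    have : Iio (0:ℝ) ⊆ ⋃ n : ℕ, Iic (-(1 / ((n:ℝ) + 1))) := by
      intro y hy
      obtain ⟨n, hn⟩ := exists_nat_one_div_lt (show 0 < -y by simpa using hy)
      exact mem_iUnion.2 ⟨n, by simp only [mem_Iic]; linarith⟩
    refine measure_mono_null this (measure_iUnion_null fun n => hρ _ ?_)
    have : (0:ℝ) < 1 / ((n:ℝ) + 1) := by positivity
    linarith
  have m1 := z μ hμ
  have m2 := z ν hν
  rw [conv_eq _ _ measurableSet_Iic, ← Measure.prod_prod]
  have sub : {q : ℝ × ℝ | q.1 + q.2 ∈ Iic x} ⊆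
      (Iic x ×ˢ Iic x) ∪ ((Iio 0 ×ˢ univ) ∪ (univ ×ˢ Iio 0)) := by
    rintro ⟨y, z⟩ hq
    have hq : y + z ≤ x := hq
    by_cases h1 : y < 0
    · right; left; exact ⟨h1, trivial⟩
    by_cases h2 : z < 0
    · right; right; exact ⟨trivial, h2⟩
    left
    push Not at h1 h2
    exact ⟨by simp only [mem_Iic]; linarith, by simp only [mem_Iic]; linarith⟩
  refine (measure_mono sub).trans ((measure_union_le _ _).trans ?_)
  have : (μ.prod ν) ((Iio 0 ×ˢ univ) ∪ (univ ×ˢ Iio 0)) = 0 := by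
    refine measure_union_null ?_ ?_
    · rw [Measure.prod_prod, m1, zero_mul]
    · rw [Measure.prod_prod, m2, mul_zero]
  rw [this, add_zero]

lemma LV.conv {μ ν : Measure ℝ} [SFinite μ] [SFinite ν] {a b : ℝ → ℝ} {α γ : ℝ}
    (hα : 0 < α + 1) (hγ : 0 < γ + 1) (h : LV μ a α) (k : LV ν b γ) :
    LV (μ.conv ν) (fun T => ProbabilityTheory.beta (γ + 1) (α + 1) * (T * (a T * b T)))
      (α + γ + 1) := by
  set B := ProbabilityTheory.beta (γ + 1) (α + 1) with hB
  have hBpos : 0 < B := ProbabilityTheory.beta_pos hγ hα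
  have hfin : ∀ x, (μ.conv ν) (Iic x) ≠ ⊤ := fun x =>
    ne_top_of_le_ne_top (ENNReal.mul_ne_top (h.fin x) (k.fin x)) (conv_Iic_le h.neg k.neg x)
  have hfin2 : ∀ x y, (μ.conv ν) (Ioc x y) ≠ ⊤ := fun x y =>
    ne_top_of_le_ne_top (hfin y) (measure_mono Ioc_subset_Iic_self)
  refine ⟨?_, hfin, ?_, ?_, ?_, ?_⟩
  · intro x hx
    have := conv_Iic_le h.neg k.neg x
    rw [h.neg x hx, zero_mul] at this
    exact le_antisymm this zero_le
  · intro T hT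
    have := h.pos T hT
    have := k.pos T hT
    positivity
  · intro c hc
    have := (((h.rv c hc).mul (k.rv c hc)).const_mul c)
    have e : c * (c ^ α * c ^ γ) = c ^ (α + γ + 1) := by
      rw [Real.rpow_add hc, Real.rpow_add hc, Real.rpow_one]; ring
    rw [e] at this
    refine this.congr' ?_
    filter_upwards [eventually_gt_atTop 0] with T hT
    have := h.pos T hT
    have := k.pos T hT
    field_simp
  · intro c d hcd
    rcases hcd.eq_or_lt with rfl | hcd
    · simp
    rw [Metric.tendsto_atTop']
    intro ε hε
    set δ := min (ε / 2) (d - c) with hδ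
    have hδ0 : 0 < δ := lt_min (by linarith) (by linarith)
    have hδ1 : δ ≤ ε / 2 := min_le_left _ _
    have hδ2 : δ ≤ d - c := min_le_right _ _
    have lo := smI_lim hα hγ h k c (d - δ) δ (by linarith) hδ0.le
    have up := smI_lim hα hγ h k (c - δ) d δ (by linarith) hδ0.le
    have lo' := lo.eventually (lt_mem_nhds (show (d - c - ε) * δ * B < (d - δ - c) * δ * B from
      mul_lt_mul_of_pos_right (mul_lt_mul_of_pos_right (by linarith) hδ0) hBpos))
    have up' := up.eventually (gt_mem_nhds (show (d - (c - δ)) * δ * B < (d - c + ε) * δ * B from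
      mul_lt_mul_of_pos_right (mul_lt_mul_of_pos_right (by linarith) hδ0) hBpos))
    obtain ⟨N, hN⟩ := eventually_atTop.1 (lo'.and up')
    refine ⟨max N 0, fun T hT => ?_⟩
    obtain ⟨l, u⟩ := hN T (le_trans (le_max_left _ _) hT.le)
    have T0 : 0 < T := lt_of_le_of_lt (le_max_right _ _) hT
    have pa := h.pos T T0
    have pb := k.pos T T0
    have i1 := smI_le μ ν c (d - δ) δ T
    have i2 := smI_ge μ ν (c - δ) d δ T
    rw [sub_add_cancel] at i1 i2
    have f1 : (smI μ ν c (d - δ) δ T).toReal ≤ δ * (μ.conv ν).real (Ioc (T + c) (T + d)) := by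
      have := ENNReal.toReal_mono (ENNReal.mul_ne_top ENNReal.ofReal_ne_top (hfin2 _ _)) i1
      rwa [ENNReal.toReal_mul, ENNReal.toReal_ofReal hδ0.le] at this
    have hft : smI μ ν (c - δ) d δ T ≠ ⊤ :=
      ne_top_of_le_ne_top (ENNReal.mul_ne_top ENNReal.ofReal_ne_top (hfin2 _ _))
        (smI_le μ ν (c - δ) d δ T)
    have f2 : δ * (μ.conv ν).real (Ioc (T + c) (T + d)) ≤ (smI μ ν (c - δ) d δ T).toReal := by
      have := ENNReal.toReal_mono hft i2
      rwa [ENNReal.toReal_mul, ENNReal.toReal_ofReal hδ0.le] at this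
    have den : 0 < T * (a T * b T) := by positivity
    rw [lt_div_iff₀ den] at l
    rw [div_lt_iff₀ den] at u
    rw [Real.dist_eq, abs_lt]
    have l2 : d - c - ε < (μ.conv ν).real (Ioc (T + c) (T + d)) / (B * (T * (a T * b T))) := by
      rw [lt_div_iff₀ (by positivity)]
      refine lt_of_mul_lt_mul_left ?_ hδ0.le
      calc _ = (d - c - ε) * δ * B * (T * (a T * b T)) := by ring
        _ < _ := l
        _ ≤ _ := f1
    have u2 : (μ.conv ν).real (Ioc (T + c) (T + d)) / (B * (T * (a T * b T))) < d - c + ε := by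
      rw [div_lt_iff₀ (by positivity)]
      refine lt_of_mul_lt_mul_left ?_ hδ0.le
      calc _ ≤ _ := f2
        _ < _ := u
        _ = _ := by ring
    constructor <;> linarith
  · obtain ⟨C1, N1, hC1, d1⟩ := h.dom
    obtain ⟨C2, N2, hC2, d2⟩ := k.dom
    refine ⟨C1 * C2, max (max N1 N2) 1, by positivity, fun s T hs hsT => ?_⟩
    have s1 : N1 ≤ s := le_trans (le_trans (le_max_left _ _) (le_max_left _ _)) hs
    have s2 : N2 ≤ s := le_trans (le_trans (le_max_right _ _) (le_max_left _ _)) hs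
    have s0 : 0 < s := lt_of_lt_of_le one_pos (le_trans (le_max_right _ _) hs)
    have := h.pos s s0
    have := k.pos s s0
    have := h.pos T (by linarith)
    have := k.pos T (by linarith)
    have T0 : 0 ≤ T := by linarith
    have e1 := d1 s T s1 hsT
    have e2 := d2 s T s2 hsT
    calc B * (s * (a s * b s)) ≤ B * (T * ((C1 * a T) * (C2 * b T))) := by gcongr
      _ = _ := by ring

/-- the Gumbel density -/
noncomputable def gk (w : ℝ) : ℝ := Real.exp (w - Real.exp w)

lemma gk_pos (w : ℝ) : 0 < gk w := Real.exp_pos _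

lemma gk_cont : Continuous gk := by unfold gk; fun_prop

lemma gk_deriv (w : ℝ) : HasDerivAt (fun w => -Real.exp (-Real.exp w)) (gk w) w := by
  have := ((Real.hasDerivAt_exp w).neg.exp).neg
  have e : gk w = -(Real.exp (-Real.exp w) * -Real.exp w) := by
    rw [show gk w = Real.exp (w - Real.exp w) from rfl, sub_eq_add_neg, Real.exp_add]
    ring
  rw [e]
  exact this

lemma integrable_expabs : Integrable (fun w : ℝ => Real.exp (-(|w| / 2))) := by
  have h1 : IntegrableOn (fun w : ℝ => Real.exp (-(|w| / 2))) (Iic 0) := by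
    refine (integrableOn_exp_mul_Iic (a := 1 / 2) (by norm_num) 0).congr_fun ?_ measurableSet_Iic
    intro w hw
    have hw : w ≤ 0 := hw
    simp only [abs_of_nonpos hw]
    congr 1; ring
  have h2 : IntegrableOn (fun w : ℝ => Real.exp (-(|w| / 2))) (Ioi 0) := by
    refine (integrableOn_exp_mul_Ioi (a := -(1 / 2)) (by norm_num) 0).congr_fun ?_ measurableSet_Ioi
    intro w hw
    have hw : 0 < w := hw
    simp only [abs_of_pos hw]
    congr 1; ring
  rw [← integrableOn_univ, ← Iic_union_Ioi (a := (0:ℝ))]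
  exact h1.union h2

lemma gk_bound (w : ℝ) : gk w * Real.exp (|w| / 2) ≤ Real.exp (-(|w| / 2)) := by
  rw [gk, ← Real.exp_add, Real.exp_le_exp]
  rcases le_total 0 w with h | h
  · rw [abs_of_nonneg h]
    have := Real.quadratic_le_exp_of_nonneg h
    nlinarith [sq_nonneg (w - 1)]
  · rw [abs_of_nonpos h]
    have := Real.exp_pos w
    linarith

lemma gk_integrable : Integrable gk := by
  refine integrable_expabs.mono' gk_cont.aestronglyMeasurable (ae_of_all _ fun w => ?_)
  rw [Real.norm_of_nonneg (gk_pos w).le]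
  refine le_trans ?_ (gk_bound w)
  exact le_mul_of_one_le_right (gk_pos w).le (Real.one_le_exp (by positivity))

lemma gk_integral : ∫ w, gk w = 1 := by
  have h1 : Tendsto (fun w => -Real.exp (-Real.exp w)) atBot (𝓝 (-1)) := by
    have := (Real.continuous_exp.tendsto 0).comp ((Real.tendsto_exp_atBot.neg).trans (by simp : 𝓝 (-(0:ℝ)) ≤ 𝓝 0))
    simpa using this.neg
  have h2 : Tendsto (fun w => -Real.exp (-Real.exp w)) atTop (𝓝 0) := by
    have := Real.tendsto_exp_neg_atTop_nhds_zero.comp Real.tendsto_exp_atTop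
    simpa using this.neg
  rw [integral_of_hasDerivAt_of_tendsto gk_deriv gk_integrable h1 h2]
  norm_num

lemma gk_lint (s t : ℝ) (hst : s ≤ t) :
    ENNReal.ofReal (Real.exp (-Real.exp s) - Real.exp (-Real.exp t)) =
      ∫⁻ w, (Ioc s t).indicator (fun w => ENNReal.ofReal (gk w)) w := by
  rw [lintegral_indicator measurableSet_Ioc, ← ofReal_integral_eq_lintegral_ofReal
    gk_integrable.integrableOn (ae_of_all _ fun w => (gk_pos w).le),
    ← intervalIntegral.integral_of_le hst,
    intervalIntegral.integral_eq_sub_of_hasDerivAt (fun x _ => gk_deriv x)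
      (gk_cont.intervalIntegrable _ _)]
  congr 1; ring

lemma gk_swap {μ : Measure ℝ} [SFinite μ] (a b T : ℝ) (hab : a ≤ b) :
    ∫⁻ x, ENNReal.ofReal (Real.exp (-Real.exp (T - x + a)) - Real.exp (-Real.exp (T - x + b))) ∂μ =
      ∫⁻ w, ENNReal.ofReal (gk w) * μ (Ioc (T - w + a) (T - w + b)) := by
  have e : ∀ x, ENNReal.ofReal
      (Real.exp (-Real.exp (T - x + a)) - Real.exp (-Real.exp (T - x + b))) =
      ∫⁻ w, {q : ℝ × ℝ | T - q.1 + a < q.2 ∧ q.2 ≤ T - q.1 + b}.indicator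
        (fun q => ENNReal.ofReal (gk q.2)) (x, w) := by
    intro x
    rw [gk_lint _ _ (by linarith)]
    rfl
  simp_rw [e]
  have hm : MeasurableSet {q : ℝ × ℝ | T - q.1 + a < q.2 ∧ q.2 ≤ T - q.1 + b} := by
    have h1 : MeasurableSet {q : ℝ × ℝ | T - q.1 + a < q.2} :=
      measurableSet_lt (by fun_prop) (by fun_prop)
    have h2 : MeasurableSet {q : ℝ × ℝ | q.2 ≤ T - q.1 + b} :=
      measurableSet_le (by fun_prop) (by fun_prop)
    exact h1.inter h2
  have hgm : Measurable gk := gk_cont.measurable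
  rw [lintegral_lintegral_swap (Measurable.aemeasurable (by
    exact Measurable.indicator (by fun_prop) hm))]
  refine lintegral_congr fun w => ?_
  rw [← lintegral_indicator_const measurableSet_Ioc]
  refine lintegral_congr fun x => ?_
  by_cases hx : x ∈ Ioc (T - w + a) (T - w + b)
  · rw [indicator_of_mem hx, indicator_of_mem]
    exact ⟨by linarith [hx.1], by linarith [hx.2]⟩
  · rw [indicator_of_notMem hx, indicator_of_notMem]
    rintro ⟨h1, h2⟩
    simp only at h1 h2
    exact hx ⟨by linarith, by linarith⟩

lemma LV.growth {μ : Measure ℝ} {g : ℝ → ℝ} {γ : ℝ} (h : LV μ g γ) :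
    ∃ N, 0 < N ∧ ∀ T, N ≤ T → ∀ n : ℕ, g (T + n) ≤ Real.exp (n / 2) * g T := by
  have h2 := (h.shift 1).eventually (gt_mem_nhds (show (1:ℝ) < Real.exp (1 / 2) by
    rw [← Real.exp_zero]; exact Real.exp_lt_exp.2 (by norm_num)))
  obtain ⟨N, hN⟩ := eventually_atTop.1 h2
  refine ⟨max N 1, by positivity, fun T hT n => ?_⟩
  have hN1 : N ≤ T := le_trans (le_max_left _ _) hT
  have h1 : 1 ≤ T := le_trans (le_max_right _ _) hT
  induction n with
  | zero => simp
  | succ n ih =>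
    have n0 : (0:ℝ) ≤ n := n.cast_nonneg
    have := hN (T + n) (by linarith)
    rw [div_lt_iff₀ (h.pos _ (by linarith))] at this
    push_cast
    rw [← add_assoc]
    refine this.le.trans ?_
    calc _ ≤ Real.exp (1 / 2) * (Real.exp (n / 2) * g T) := by gcongr
      _ = Real.exp (((n:ℝ) + 1) / 2) * g T := by
        rw [← mul_assoc, ← Real.exp_add]; congr 2; ring

lemma LV.phi {μ : Measure ℝ} [SFinite μ] {g : ℝ → ℝ} {γ : ℝ} (h : LV μ g γ) (a b : ℝ)
    (hab : a ≤ b) :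
    Tendsto (fun T => (∫⁻ x, ENNReal.ofReal
      (Real.exp (-Real.exp (T - x + a)) - Real.exp (-Real.exp (T - x + b))) ∂μ).toReal / g T) atTop
      (𝓝 (b - a)) := by
  obtain ⟨C, N1, hC, hb⟩ := h.bound a b 0 hab
  obtain ⟨N2, hN2, hgr⟩ := h.growth
  have key : Tendsto (fun T => ∫ w, gk w * (μ.real (Ioc (T + (-w + a)) (T + (-w + b))) / g T)) atTop
      (𝓝 (∫ w, gk w * (b - a))) := by
    refine tendsto_integral_filter_of_dominated_convergence
      (fun w => C * Real.exp (1 / 2) * Real.exp (-(|w| / 2))) ?_ ?_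
      (integrable_expabs.const_mul _) ?_
    · refine Eventually.of_forall fun T => Measurable.aestronglyMeasurable ?_
      have m1 : Measurable (fun w : ℝ => μ.real (Ioc (T + (-w + a)) (T + (-w + b)))) := by
        have := ((LV.meas (μ := μ) a b).ennreal_toReal).comp
          (g := fun s => (μ (Ioc (s + a) (s + b))).toReal) (f := fun w => T + -w) (by fun_prop)
        simpa only [Function.comp_def, add_assoc, Measure.real] using this
      exact gk_cont.measurable.mul (m1.div_const _)
    · filter_upwards [eventually_ge_atTop N1, eventually_ge_atTop N2] with T t1 t2
      refine ae_of_all _ fun w => ?_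
      have gT := h.pos T (by linarith)
      have gw := gk_pos w
      rw [Real.norm_of_nonneg (by positivity)]
      set n := ⌈|w|⌉₊ with hn
      have n1 : |w| ≤ n := Nat.le_ceil _
      have n2 : (n:ℝ) < |w| + 1 := Nat.ceil_lt_add_one (abs_nonneg _)
      have n0 : (0:ℝ) ≤ n := n.cast_nonneg
      have b1 := hb (T + n) (by linarith) (T + -w) (by linarith [neg_abs_le w])
      have b2 := hgr T t2 n
      have b3 : μ.real (Ioc (T + (-w + a)) (T + (-w + b))) / g T ≤ C * Real.exp (n / 2) := by
        rw [div_le_iff₀ gT, ← add_assoc, ← add_assoc]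
        refine b1.trans ?_
        rw [mul_assoc]
        exact mul_le_mul_of_nonneg_left b2 hC.le
      have b4 : Real.exp (n / 2) ≤ Real.exp (1 / 2) * Real.exp (|w| / 2) := by
        rw [← Real.exp_add, Real.exp_le_exp]; linarith
      calc _ ≤ gk w * (C * (Real.exp (1 / 2) * Real.exp (|w| / 2))) := by
            gcongr
            exact b3.trans (by gcongr)
        _ = C * Real.exp (1 / 2) * (gk w * Real.exp (|w| / 2)) := by ring
        _ ≤ _ := by
            gcongr
            exact gk_bound w
    · refine ae_of_all _ fun w => ?_
      have := (h.inc (-w + a) (-w + b) (by linarith)).const_mul (gk w)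
      convert this using 2
      ring
  rw [integral_mul_const, gk_integral, one_mul] at key
  refine key.congr fun T => ?_
  rw [gk_swap a b T hab, ← integral_toReal]
  · rw [← integral_div]
    refine integral_congr_ae (ae_of_all _ fun w => ?_)
    simp only [ENNReal.toReal_mul, ENNReal.toReal_ofReal (gk_pos w).le, Measure.real]
    rw [mul_div_assoc, sub_eq_add_neg, add_assoc, add_assoc]
  · have hgm : Measurable gk := gk_cont.measurable
    have m1 : Measurable (fun w : ℝ => μ (Ioc (T - w + a) (T - w + b))) :=
      (LV.meas (μ := μ) a b).comp (g := fun s => μ (Ioc (s + a) (s + b)))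
        (f := fun w => T - w) (by fun_prop)
    exact (Measurable.mul (by fun_prop) m1).aemeasurable
  · exact ae_of_all _ fun w => ENNReal.mul_lt_top ENNReal.ofReal_lt_top (h.fin_Ioc _ _).lt_top

lemma dom_of {F g : ℝ → ℝ} {β : ℝ} (hβ : 0 < β) (hF : Monotone F) (gpos : ∀ T > 0, 0 < g T)
    (rv : ∀ c > 0, Tendsto (fun T => g (c * T) / g T) atTop (𝓝 (c ^ β)))
    (inc : ∀ c d, c ≤ d → Tendsto (fun T => (F (T + d) - F (T + c)) / g T) atTop (𝓝 (d - c))) :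
    ∃ C N, 0 < C ∧ ∀ s T, N ≤ s → s ≤ T → g s ≤ C * g T := by
  set E : ℕ → Set ℝ := fun n => {θ | ∀ T, (n:ℝ) ≤ T → g T ≤ n * g (Real.exp θ * T)} with hE
  have hcov : ⋃ n, closure (E n) = univ := by
    refine eq_univ_of_forall fun θ => ?_
    set c := Real.exp θ with hc
    have c0 : 0 < c := Real.exp_pos _
    have cb : 0 < c ^ β := Real.rpow_pos_of_pos c0 _
    have h1 := (rv c c0).eventually (lt_mem_nhds (show c ^ β / 2 < c ^ β by linarith))
    obtain ⟨N, hN⟩ := eventually_atTop.1 h1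
    obtain ⟨n, hn⟩ := exists_nat_ge (max (max N 1) (2 / c ^ β))
    refine mem_iUnion.2 ⟨n, subset_closure ?_⟩
    intro T hT
    have nN : N ≤ T := ((le_max_left _ _).trans (le_max_left _ _)).trans (hn.trans hT)
    have n1 : 1 ≤ T := ((le_max_right _ _).trans (le_max_left _ _)).trans (hn.trans hT)
    have n2 : 2 / c ^ β ≤ n := (le_max_right _ _).trans hn
    have := hN T nN
    have gT := gpos T (by linarith)
    have gcT := gpos (c * T) (by positivity)
    rw [lt_div_iff₀ gT] at this
    rw [div_le_iff₀ cb] at n2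
    nlinarith
  obtain ⟨n, θ0, hθ0⟩ := nonempty_interior_of_iUnion_of_closed (fun n => isClosed_closure) hcov
  obtain ⟨ε, hε, hball⟩ := Metric.isOpen_iff.1 isOpen_interior θ0 hθ0
  have hcl : ∀ θ, θ0 ≤ θ → θ ≤ θ0 + ε / 2 → θ ∈ closure (E n) := by
    intro θ h1 h2
    refine interior_subset (hball ?_)
    rw [Metric.mem_ball, Real.dist_eq, abs_lt]
    constructor <;> linarith
  -- uniform bound on the closure
  have i1 := (inc 0 1 zero_le_one).eventually (lt_mem_nhds (show (1:ℝ) / 2 < 1 - 0 by norm_num))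
  obtain ⟨N1, hN1⟩ := eventually_atTop.1 i1
  have i2 := (inc (-1) 2 (by norm_num)).eventually (gt_mem_nhds (show (2:ℝ) - (-1) < 4 by norm_num))
  obtain ⟨N2, hN2⟩ := eventually_atTop.1 i2
  set M : ℝ := max (max N1 N2) 1 with hM
  have hM1 : N1 ≤ M := (le_max_left _ _).trans (le_max_left _ _)
  have hM2 : N2 ≤ M := (le_max_right _ _).trans (le_max_left _ _)
  have hM3 : 1 ≤ M := le_max_right _ _
  set c0 := Real.exp θ0 with hc0
  have c0pos : 0 < c0 := Real.exp_pos _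
  have step1 : ∀ θ, θ0 ≤ θ → θ ≤ θ0 + ε / 2 → ∀ T, max (max (n:ℝ) ((M + 1) / c0)) 1 ≤ T →
      g T ≤ 8 * n * g (Real.exp θ * T) := by
    intro θ h1 h2 T hT
    have tn : (n:ℝ) ≤ T := ((le_max_left _ _).trans (le_max_left _ _)).trans hT
    have tM : (M + 1) / c0 ≤ T := ((le_max_right _ _).trans (le_max_left _ _)).trans hT
    have t1 : 1 ≤ T := (le_max_right _ _).trans hT
    rw [div_le_iff₀ c0pos] at tM
    have cle : c0 ≤ Real.exp θ := Real.exp_le_exp.2 h1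
    have cT : M + 1 ≤ Real.exp θ * T := by nlinarith
    have hcont : ContinuousAt (fun θ => Real.exp θ * T) θ := by fun_prop
    obtain ⟨η, hη, hηc⟩ := Metric.continuousAt_iff.1 hcont 1 one_pos
    obtain ⟨θ', hθ', hd⟩ := Metric.mem_closure_iff.1 (hcl θ h1 h2) η hη
    rw [dist_comm] at hd
    have hd2 := hηc hd
    rw [Real.dist_eq, abs_lt] at hd2
    have b1 := hθ' T tn
    have gp := gpos (Real.exp θ' * T) (by positivity)
    have gp2 := gpos (Real.exp θ * T) (by positivity)
    have b2 := hN1 (Real.exp θ' * T) (by linarith)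
    rw [lt_div_iff₀ gp] at b2
    have b3 := hN2 (Real.exp θ * T) (by linarith)
    rw [div_lt_iff₀ gp2] at b3
    have b4 : F (Real.exp θ' * T + 1) ≤ F (Real.exp θ * T + 2) := hF (by linarith)
    have b5 : F (Real.exp θ * T + -1) ≤ F (Real.exp θ' * T + 0) := hF (by linarith)
    have b6 : g (Real.exp θ' * T) ≤ 8 * g (Real.exp θ * T) := by linarith
    have n0 : (0:ℝ) ≤ n := n.cast_nonneg
    nlinarith [mul_le_mul_of_nonneg_left b6 n0]
  have i3 := (rv c0 c0pos).eventually (gt_mem_nhds (show c0 ^ β < c0 ^ β + 1 by linarith))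
  obtain ⟨N3, hN3⟩ := eventually_atTop.1 i3
  set L := max (max (max (n:ℝ) ((M + 1) / c0)) 1) N3 with hL
  set q := Real.exp (ε / 2) with hq
  have q1 : 1 < q := by rw [hq, ← Real.exp_zero]; exact Real.exp_lt_exp.2 (by linarith)
  set C1 := (c0 ^ β + 1) * (8 * n) with hC1
  have step2 : ∀ s, c0 * L ≤ s → ∀ c, 1 ≤ c → c ≤ q → g s ≤ C1 * g (c * s) := by
    intro s hs c hc1 hcq
    set S := s / c0 with hS
    have hsS : s = c0 * S := by rw [hS]; field_simp
    have hLS : L ≤ S := by rw [hS, le_div_iff₀ c0pos]; linarith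
    have a1 := hN3 S ((le_max_right _ _).trans hLS)
    have S1 : 1 ≤ S := ((le_max_right _ _).trans (le_max_left _ _)).trans hLS
    rw [div_lt_iff₀ (gpos S (by linarith))] at a1
    have cpos : 0 < c := by linarith
    have a2 := step1 (θ0 + Real.log c) (by linarith [Real.log_nonneg hc1])
      (by have := Real.log_le_log cpos hcq
          rw [hq, Real.log_exp] at this; linarith) S ((le_max_left _ _).trans hLS)
    rw [Real.exp_add, Real.exp_log cpos, ← hc0] at a2
    have e : c0 * c * S = c * s := by rw [hsS]; ring
    rw [e] at a2
    have cb : 0 < c0 ^ β := Real.rpow_pos_of_pos c0pos _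
    rw [hC1, mul_assoc]
    calc g s = g (c0 * S) := by rw [← hsS]
      _ ≤ (c0 ^ β + 1) * g S := a1.le
      _ ≤ _ := by gcongr
  have i4 := (rv q (by linarith)).eventually (lt_mem_nhds
    (show 1 < q ^ β from Real.one_lt_rpow q1 hβ))
  obtain ⟨N4, hN4⟩ := eventually_atTop.1 i4
  have hpow : ∀ m : ℕ, ∀ s, max N4 1 ≤ s → g s ≤ g (q ^ m * s) := by
    intro m
    induction m with
    | zero => intro s _; simp
    | succ m ih =>
      intro s hs
      have s1 : 1 ≤ s := (le_max_right _ _).trans hs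
      have := hN4 s ((le_max_left _ _).trans hs)
      rw [lt_div_iff₀ (gpos s (by linarith)), one_mul] at this
      have h2 := ih (q * s) (by nlinarith)
      rw [pow_succ, mul_assoc]
      exact this.le.trans h2
  refine ⟨C1 + 1, max (max N4 1) (c0 * L), by positivity, fun s T hs hsT => ?_⟩
  have s4 : max N4 1 ≤ s := (le_max_left _ _).trans hs
  have s1 : 1 ≤ s := (le_max_right _ _).trans s4
  have sL : c0 * L ≤ s := (le_max_right _ _).trans hs
  obtain ⟨m, hm1, hm2⟩ := exists_nat_pow_near (show 1 ≤ T / s by rw [le_div_iff₀ (by linarith)]; linarith) q1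
  have qm : 0 < q ^ m := by positivity
  set c := T / s / q ^ m with hc
  have hc1 : 1 ≤ c := by rw [hc, le_div_iff₀ qm]; linarith
  have hcq : c ≤ q := by
    rw [hc, div_le_iff₀ qm]; rw [pow_succ] at hm2; linarith
  have a1 := step2 s sL c hc1 hcq
  have a2 := hpow m (c * s) (by nlinarith)
  have e : q ^ m * (c * s) = T := by rw [hc]; field_simp
  rw [e] at a2
  have gT := gpos T (by linarith)
  have C10 : 0 ≤ C1 := by positivity
  nlinarith [mul_le_mul_of_nonneg_left a2 C10]

/-- the point process of the values `-log p_k` -/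
noncomputable def base (p : ℕ → ℝ) : Measure ℝ :=
  (Measure.count.restrict {k | 0 < p k}).map (fun k => -Real.log (p k))

instance (p : ℕ → ℝ) : SFinite (base p) := by unfold base; infer_instance

/-- its convolution powers -/
noncomputable def cp (p : ℕ → ℝ) : ℕ → Measure ℝ
  | 0 => Measure.dirac 0
  | j + 1 => (base p).conv (cp p j)

instance cp_sfinite (p : ℕ → ℝ) (j : ℕ) : SFinite (cp p j) := by
  induction j with
  | zero => unfold cp; infer_instance
  | succ j ih => unfold cp; infer_instance

lemma lintegral_base (p : ℕ → ℝ) {f : ℝ → ENNReal} (hf : Measurable f) :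
    ∫⁻ x, f x ∂(base p) = ∑' k, {k | 0 < p k}.indicator (fun k => f (-Real.log (p k))) k := by
  rw [base, lintegral_map hf (Measurable.of_discrete), ← lintegral_indicator (MeasurableSet.of_discrete),
    lintegral_count]

lemma lintegral_cp (p : ℕ → ℝ) (hp0 : ∀ k, 0 ≤ p k) (j : ℕ) : ∀ {f : ℝ → ENNReal}, Measurable f →
    ∫⁻ x, f x ∂(cp p j) =
      ∑' r, {r | 0 < prodP p j r}.indicator (fun r => f (-Real.log (prodP p j r))) r := by
  induction j with
  | zero =>
    intro f hf
    rw [cp, lintegral_dirac' _ hf, tsum_eq_single default (fun b hb => absurd (Subsingleton.elim _ _) hb)]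
    simp [prodP]
  | succ j ih =>
    intro f hf
    rw [cp, Measure.lintegral_conv hf]
    have e : ∀ x, ∫⁻ y, f (x + y) ∂(cp p j) = ∑' r, {r | 0 < prodP p j r}.indicator
        (fun r => f (x + -Real.log (prodP p j r))) r := fun x =>
      ih (f := fun y => f (x + y)) (by fun_prop)
    have hm : Measurable (fun x => ∫⁻ y, f (x + y) ∂(cp p j)) :=
      Measurable.lintegral_prod_right' (f := fun q : ℝ × ℝ => f (q.1 + q.2)) (by fun_prop)
    rw [lintegral_base p hm, ← (Fin.consEquiv (fun _ : Fin (j + 1) => ℕ)).tsum_eq, ENNReal.tsum_prod']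
    refine tsum_congr fun k => ?_
    have hprod : ∀ r : Fin j → ℕ, prodP p (j + 1) (Fin.cons k r : Fin (j + 1) → ℕ) =
        p k * prodP p j r := by
      intro r; simp [prodP, Fin.prod_univ_succ]
    have hnn : ∀ r : Fin j → ℕ, 0 ≤ prodP p j r := fun r => Finset.prod_nonneg fun i _ => hp0 _
    by_cases hk : 0 < p k
    · rw [indicator_of_mem (show k ∈ {k | 0 < p k} from hk), e]
      refine tsum_congr fun r => ?_
      change _ = indicator _ _ (Fin.cons k r : Fin (j + 1) → ℕ)
      by_cases hr : 0 < prodP p j r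
      · rw [indicator_of_mem (show r ∈ {r | 0 < prodP p j r} from hr), indicator_of_mem, hprod,
          Real.log_mul hk.ne' hr.ne', neg_add]
        simp only [mem_ofPred_eq]
        rw [hprod]; positivity
      · rw [indicator_of_notMem (show r ∉ {r | 0 < prodP p j r} from hr), indicator_of_notMem]
        simp only [mem_ofPred_eq]
        have : prodP p j r = 0 := le_antisymm (not_lt.1 hr) (hnn r)
        rw [hprod, this]; simp
    · rw [indicator_of_notMem (show k ∉ {k | 0 < p k} from hk)]
      symm
      rw [ENNReal.tsum_eq_zero]
      intro r
      change indicator _ _ (Fin.cons k r : Fin (j + 1) → ℕ) = _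
      rw [indicator_of_notMem]
      simp only [mem_ofPred_eq]
      have : p k = 0 := le_antisymm (not_lt.1 hk) (hp0 k)
      rw [hprod, this]; simp

lemma summable_prodP (p : ℕ → ℝ) (hp0 : ∀ k, 0 ≤ p k) (hs : Summable p) (j : ℕ) :
    Summable (prodP p j) := by
  induction j with
  | zero => exact Summable.of_finite
  | succ j ih =>
    rw [← (Fin.consEquiv (fun _ : Fin (j + 1) => ℕ)).summable_iff]
    have := hs.mul_of_nonneg ih hp0 (fun r => Finset.prod_nonneg fun i _ => hp0 _)
    refine this.congr fun q => ?_
    simp [prodP, Fin.prod_univ_succ, Fin.consEquiv]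

lemma phi_eq (p : ℕ → ℝ) (hp0 : ∀ k, 0 ≤ p k) (hs : Summable p) (j : ℕ) (a b T : ℝ) (hab : a ≤ b) :
    PhiJ p j (Real.exp (T + b)) - PhiJ p j (Real.exp (T + a)) =
      (∫⁻ x, ENNReal.ofReal
      (Real.exp (-Real.exp (T - x + a)) - Real.exp (-Real.exp (T - x + b))) ∂(cp p j)).toReal := by
  have hnn : ∀ r : Fin j → ℕ, 0 ≤ prodP p j r := fun r => Finset.prod_nonneg fun i _ => hp0 _
  have hsum : ∀ t : ℝ, 0 ≤ t → Summable (fun r => 1 - Real.exp (-t * prodP p j r)) := by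
    intro t ht
    refine Summable.of_nonneg_of_le (fun r => ?_) (fun r => ?_)
      ((summable_prodP p hp0 hs j).mul_left t)
    · have : Real.exp (-t * prodP p j r) ≤ 1 := Real.exp_le_one_iff.2 (by
        have := mul_nonneg ht (hnn r); linarith)
      linarith
    · have := Real.add_one_le_exp (-t * prodP p j r)
      linarith
  have s1 := hsum _ (Real.exp_pos (T + b)).le
  have s2 := hsum _ (Real.exp_pos (T + a)).le
  have hle : ∀ r, 0 ≤ (1 - Real.exp (-Real.exp (T + b) * prodP p j r)) -
      (1 - Real.exp (-Real.exp (T + a) * prodP p j r)) := by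
    intro r
    have : Real.exp (-Real.exp (T + b) * prodP p j r) ≤ Real.exp (-Real.exp (T + a) * prodP p j r) := by
      rw [Real.exp_le_exp]
      refine mul_le_mul_of_nonneg_right ?_ (hnn r)
      exact neg_le_neg (Real.exp_le_exp.2 (by linarith))
    linarith
  rw [PhiJ, PhiJ, ← s1.tsum_sub s2, lintegral_cp p hp0 j (by fun_prop)]
  have e : ∀ r, {r | 0 < prodP p j r}.indicator (fun r => ENNReal.ofReal
      (Real.exp (-Real.exp (T - -Real.log (prodP p j r) + a)) -
        Real.exp (-Real.exp (T - -Real.log (prodP p j r) + b)))) r = ENNReal.ofReal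
      ((1 - Real.exp (-Real.exp (T + b) * prodP p j r)) -
      (1 - Real.exp (-Real.exp (T + a) * prodP p j r))) := by
    intro r
    by_cases hr : 0 < prodP p j r
    · rw [indicator_of_mem (show r ∈ {r | 0 < prodP p j r} from hr)]
      have e1 : ∀ a, Real.exp (T - -Real.log (prodP p j r) + a) = Real.exp (T + a) * prodP p j r := by
        intro a
        rw [show T - -Real.log (prodP p j r) + a = (T + a) + Real.log (prodP p j r) by ring,
          Real.exp_add, Real.exp_log hr]
      rw [e1, e1, neg_mul, neg_mul]
      congr 1; ring
    · rw [indicator_of_notMem (show r ∉ {r | 0 < prodP p j r} from hr)]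
      have : prodP p j r = 0 := le_antisymm (not_lt.1 hr) (hnn r)
      rw [this]; simp
  simp_rw [e]
  rw [← ENNReal.ofReal_tsum_of_nonneg hle (s1.sub s2), ENNReal.toReal_ofReal (tsum_nonneg hle)]

lemma base_Iic (p : ℕ → ℝ) (T : ℝ) :
    base p (Iic T) = ({k | Real.exp (-T) ≤ p k}.encard : ENNReal) := by
  rw [base, Measure.map_apply (Measurable.of_discrete) measurableSet_Iic,
    Measure.restrict_apply (MeasurableSet.of_discrete), Measure.count_apply MeasurableSet.of_discrete]
  congr 2
  ext k
  simp only [mem_inter_iff, mem_preimage, mem_Iic, mem_ofPred_eq]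
  constructor
  · rintro ⟨h1, h2⟩
    rw [← Real.le_log_iff_exp_le h2]; linarith
  · intro h
    have h2 : 0 < p k := lt_of_lt_of_le (Real.exp_pos _) h
    rw [← Real.le_log_iff_exp_le h2] at h
    exact ⟨by linarith, h2⟩

lemma rho_eq (p : ℕ → ℝ) (T : ℝ) : rhoJ p 1 (Real.exp T) = (base p).real (Iic T) := by
  rw [Measure.real, base_Iic, rhoJ]
  have : Nat.card {r : Fin 1 → ℕ // 1 / Real.exp T ≤ prodP p 1 r} =
      Nat.card {k | Real.exp (-T) ≤ p k} := by
    refine Nat.card_congr ((Equiv.funUnique (Fin 1) ℕ).subtypeEquiv fun r => ?_)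
    simp [prodP, Real.exp_neg]
  rw [this, Nat.card_coe_set_eq, ncard]
  cases h : {k | Real.exp (-T) ≤ p k}.encard <;> simp

lemma base_LV (p : ℕ → ℝ) (hp0 : ∀ k, 0 ≤ p k) (hp1 : ∑' k, p k = 1)
    (β : ℝ) (hβ : 0 ≤ β)
    (ℓ : ℝ → ℝ) (hℓpos : ∀ x > 0, 0 < ℓ x)
    (hℓsv : ∀ c > 0, Tendsto (fun x => ℓ (c * x) / ℓ x) atTop (𝓝 1))
    (h6 : ∀ lam > 0, Tendsto
      (fun t => (rhoJ p 1 (lam * t) - rhoJ p 1 t) / (Real.log t ^ β * ℓ (Real.log t)))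
      atTop (𝓝 (Real.log lam)))
    (h60 : β = 0 → (∃ x₀, MonotoneOn ℓ (Set.Ici x₀)) ∧ Tendsto ℓ atTop atTop) :
    LV (base p) (fun T => T ^ β * ℓ T) β := by
  have hs : Summable p := by
    by_contra h
    rw [tsum_eq_zero_of_not_summable h] at hp1
    norm_num at hp1
  have hle1 : ∀ k, p k ≤ 1 := fun k => hp1 ▸ hs.le_tsum k (fun i _ => hp0 i)
  have hfin : ∀ x, base p (Iic x) ≠ ⊤ := by
    intro x
    rw [base_Iic]
    have : {k | Real.exp (-x) ≤ p k}.Finite := by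
      have := hs.tendsto_cofinite_zero.eventually (gt_mem_nhds (Real.exp_pos (-x)))
      rw [eventually_cofinite] at this
      simpa only [not_lt] using this
    rw [this.encard_eq_coe_toFinset_card]
    simp
  have gpos : ∀ T > 0, 0 < T ^ β * ℓ T := fun T hT =>
    mul_pos (Real.rpow_pos_of_pos hT _) (hℓpos T hT)
  have rv : ∀ c > 0, Tendsto (fun T => ((c * T) ^ β * ℓ (c * T)) / (T ^ β * ℓ T)) atTop
      (𝓝 (c ^ β)) := by
    intro c hc
    have := (hℓsv c hc).const_mul (c ^ β)
    rw [mul_one] at this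
    refine this.congr' ?_
    filter_upwards [eventually_gt_atTop 0] with T hT
    have h1 := hℓpos T hT
    have h2 : 0 < T ^ β := Real.rpow_pos_of_pos hT _
    rw [Real.mul_rpow hc.le hT.le]
    field_simp
  have hmono : Monotone (fun T => (base p).real (Iic T)) := fun x y hxy =>
    measureReal_mono (Iic_subset_Iic.2 hxy) (hfin y)
  have inc0 : ∀ h : ℝ, Tendsto (fun T => ((base p).real (Iic (T + h)) - (base p).real (Iic T)) /
      (T ^ β * ℓ T)) atTop (𝓝 h) := by
    intro h
    have := (h6 (Real.exp h) (Real.exp_pos h)).comp Real.tendsto_exp_atTop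
    rw [Real.log_exp] at this
    refine this.congr fun T => ?_
    simp only [Function.comp, Real.log_exp]
    rw [← Real.exp_add, rho_eq, rho_eq, add_comm h T]
  have inc : ∀ c d : ℝ, c ≤ d → Tendsto (fun T => ((base p).real (Iic (T + d)) -
      (base p).real (Iic (T + c))) / (T ^ β * ℓ T)) atTop (𝓝 (d - c)) := by
    intro c d _
    refine ((inc0 d).sub (inc0 c)).congr fun T => ?_
    ring
  refine ⟨?_, hfin, gpos, rv, ?_, ?_⟩
  · intro x hx
    rw [base_Iic]
    have : {k | Real.exp (-x) ≤ p k} = ∅ := by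
      ext k
      simp only [mem_ofPred_eq, mem_empty_iff_false, iff_false, not_le]
      exact (hle1 k).trans_lt (Real.one_lt_exp_iff.2 (by linarith))
    simp [this]
  · intro c d hcd
    refine (inc c d hcd).congr fun T => ?_
    congr 1
    have hIoc : Ioc (T + c) (T + d) = Iic (T + d) \ Iic (T + c) := by
      ext x
      simp only [mem_Ioc, mem_diff, mem_Iic, not_le]
      tauto
    rw [hIoc, measureReal_diff (Iic_subset_Iic.2 (by linarith)) measurableSet_Iic (hfin _)]
  · rcases hβ.eq_or_lt with h0 | h0
    · obtain ⟨⟨x0, hx0⟩, _⟩ := h60 h0.symm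
      refine ⟨1, x0, one_pos, fun s T hs hsT => ?_⟩
      rw [← h0]
      simp only [Real.rpow_zero, one_mul]
      exact hx0 hs (hs.trans hsT) hsT
    · exact dom_of h0 hmono gpos rv inc

lemma cp_LV (p : ℕ → ℝ) (β : ℝ) (hβ : 0 ≤ β) (g : ℝ → ℝ) (h : LV (base p) g β) (n : ℕ) :
    LV (cp p (n + 1)) (fun T => Real.Gamma (β + 1) ^ (n + 1) / Real.Gamma (((n + 1 : ℕ) : ℝ) * (β + 1))
      * (T ^ n * g T ^ (n + 1))) (((n + 1 : ℕ) : ℝ) * (β + 1) - 1) := by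
  have G : ∀ x : ℝ, 0 < x → Real.Gamma x ≠ 0 := fun x hx => (Real.Gamma_pos_of_pos hx).ne'
  induction n with
  | zero =>
    have e : cp p (0 + 1) = base p := by
      simp [cp, Measure.conv_dirac_zero]
    rw [e]
    convert h using 1
    · funext T
      have := G (β + 1) (by linarith)
      simp [this]
    · simp
  | succ n ih =>
    have hn : (0:ℝ) < ((n + 1 : ℕ) : ℝ) * (β + 1) := by positivity
    have := LV.conv (by linarith) (by linarith) h ih
    rw [cp]
    convert this using 1
    · funext T
      have g1 := G _ hn
      have g2 := G (((n + 1 + 1 : ℕ) : ℝ) * (β + 1)) (by positivity)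
      rw [ProbabilityTheory.beta]
      have e : ((n + 1 : ℕ) : ℝ) * (β + 1) - 1 + 1 + (β + 1) = ((n + 1 + 1 : ℕ) : ℝ) * (β + 1) := by
        push_cast; ring
      rw [e, sub_add_cancel]
      field_simp
      ring
    · push_cast; ring

end Karlin

theorem stmt5
    (p : ℕ → ℝ) (hp0 : ∀ k, 0 ≤ p k) (hp1 : ∑' k, p k = 1)
    (hpinf : {k | 0 < p k}.Infinite)
    (β : ℝ) (hβ : 0 ≤ β)
    (ℓ : ℝ → ℝ) (hℓpos : ∀ x > 0, 0 < ℓ x)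
    (hℓsv : ∀ c > 0, Tendsto (fun x => ℓ (c * x) / ℓ x) atTop (𝓝 1))
    (h6 : ∀ lam > 0, Tendsto
      (fun t => (rhoJ p 1 (lam * t) - rhoJ p 1 t) / (Real.log t ^ β * ℓ (Real.log t)))
      atTop (𝓝 (Real.log lam)))
    (h60 : β = 0 → (∃ x₀, MonotoneOn ℓ (Set.Ici x₀)) ∧ Tendsto ℓ atTop atTop)
    (j : ℕ) (hj : 1 ≤ j) (u v : ℝ) :
    Tendsto
      (fun T => (PhiJ p j (Real.exp (T + u) + Real.exp (T + v)) -
          PhiJ p j (max (Real.exp (T + u)) (Real.exp (T + v)))) /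
        (T ^ ((j : ℝ) * β + j - 1) * (ℓ T) ^ j))
      atTop
      (𝓝 ((Real.Gamma (β + 1)) ^ j / Real.Gamma (j * (β + 1)) *
        Real.log (1 + Real.exp (-|u - v|)))) := by

  have hs : Summable p := by
    by_contra h
    rw [tsum_eq_zero_of_not_summable h] at hp1
    norm_num at hp1
  obtain ⟨n, rfl⟩ : ∃ n, j = n + 1 := ⟨j - 1, by omega⟩
  have hLV := Karlin.cp_LV p β hβ _
    (Karlin.base_LV p hp0 hp1 β hβ ℓ hℓpos hℓsv h6 h60) n
  set c := Real.Gamma (β + 1) ^ (n + 1) / Real.Gamma (((n + 1 : ℕ) : ℝ) * (β + 1)) with hc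
  have hc0 : 0 < c := by
    have h1 : 0 < Real.Gamma (β + 1) := Real.Gamma_pos_of_pos (by linarith)
    have h2 : 0 < Real.Gamma (((n + 1 : ℕ) : ℝ) * (β + 1)) :=
      Real.Gamma_pos_of_pos (by positivity)
    positivity
  set b := Real.log (Real.exp u + Real.exp v) with hb
  have heb : Real.exp b = Real.exp u + Real.exp v := Real.exp_log (by positivity)
  have hab : max u v ≤ b := by
    rw [← Real.exp_le_exp, heb]
    rcases max_cases u v with h | h <;> rw [h.1] <;> linarith [Real.exp_pos u, Real.exp_pos v]
  have hba : b - max u v = Real.log (1 + Real.exp (-|u - v|)) := by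
    have : Real.exp (max u v) * (1 + Real.exp (-|u - v|)) = Real.exp u + Real.exp v := by
      rw [mul_add, mul_one, ← Real.exp_add]
      rcases le_total u v with h | h
      · rw [max_eq_right h, abs_of_nonpos (by linarith), add_comm]
        congr 2; ring
      · rw [max_eq_left h, abs_of_nonneg (by linarith)]
        congr 2; ring
    rw [hb, ← this, Real.log_mul (Real.exp_pos _).ne' (by positivity), Real.log_exp]
    ring
  have key := (hLV.phi (max u v) b hab).const_mul c
  rw [hba] at key
  refine key.congr' ?_
  filter_upwards [eventually_gt_atTop 0] with T hT
  rw [← Karlin.phi_eq p hp0 hs (n + 1) (max u v) b T hab]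
  have e1 : Real.exp (T + b) = Real.exp (T + u) + Real.exp (T + v) := by
    rw [Real.exp_add, heb, Real.exp_add, Real.exp_add]; ring
  have e2 : Real.exp (T + max u v) = max (Real.exp (T + u)) (Real.exp (T + v)) := by
    rw [← Real.exp_monotone.map_max, max_add_add_left]
  have e3 : T ^ n * (T ^ β * ℓ T) ^ (n + 1) =
      T ^ (((n + 1 : ℕ) : ℝ) * β + ((n + 1 : ℕ) : ℝ) - 1) * ℓ T ^ (n + 1) := by
    rw [mul_pow, ← mul_assoc, ← Real.rpow_natCast T n, ← Real.rpow_mul_natCast hT.le,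
      ← Real.rpow_add hT]
    congr 2
    push_cast; ring
  rw [e1, e2, e3, ← mul_div_assoc, mul_div_mul_left _ _ hc0.ne']
end
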